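/- arXiv:2004.14318 — 3 statements merged into one kernel-verified Lean document; each statement's English description precedes it below -/
import Mathlib

section
/- Let n ∈ ℕ and let G ⊆ K_{n,n} be a sorted ordered graph with representing sequence (d_1,k_1), …, (d_t,k_t), and set k_0 = 0. Define f(m,d,k) = C(m−1, k) if d ≤ 0, and f(m,d,k) = −C(m−d−1, k−d)·C(k−1, d−1) if d > 0, where C(a,b) denotes the binomial coefficient (taken to be 0 when b > a or a < 0). Then the dual coefficient of G equals a*_G = C(n−k_{t−1}−1, n−d_t) · ∏_{i=1}^{t−1} f(d_{i+1}−k_{i−1}, d_i−k_{i−1}, k_i−k_{i−1}). -/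
open Finset

/-- An edge set `E ⊆ {1,…,n}×{1,…,n}` contains a perfect matching. -/
def hasPM (n : ℕ) (E : Finset (Fin n × Fin n)) : Prop :=
  ∃ σ : Equiv.Perm (Fin n), ∀ i : Fin n, (i, σ i) ∈ E

open scoped Classical in
/-- The Boolean dual of the bipartite perfect matching function: `1` iff the
complement of `E` contains no perfect matching, `0` otherwise. -/
noncomputable def bpmStar (n : ℕ) (E : Finset (Fin n × Fin n)) : ℝ :=
  if hasPM n (Finset.univ \ E) then 0 else 1

/-- The dual coefficient `a*_G` of a graph `G ⊆ K_{n,n}`: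
`a*_G = Σ_{F ⊆ E(G)} (−1)^{|E(G)\F|} · BPM*_n(F)`. -/
noncomputable def dualCoeff (n : ℕ) (G : Finset (Fin n × Fin n)) : ℝ :=
  ∑ F ∈ G.powerset, (-1 : ℝ) ^ ((G \ F).card) * bpmStar n F

/-- Extended binomial coefficient `C(a,b)` over `ℤ`, equal to `0` when `a < 0`,
`b < 0` or `b > a`. -/
def intChoose (a b : ℤ) : ℤ :=
  if 0 ≤ a ∧ 0 ≤ b ∧ b ≤ a then (a.toNat.choose b.toNat : ℤ) else 0

/-- `f(m,d,k) = C(m−1,k)` if `d ≤ 0` and `−C(m−d−1,k−d)·C(k−1,d−1)` if `d > 0`. -/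
def fcoef (m d k : ℤ) : ℤ :=
  if d ≤ 0 then intChoose (m - 1) k
  else -(intChoose (m - d - 1) (k - d) * intChoose (k - 1) (d - 1))

section Staircase

variable {α β : Type*} [DecidableEq α] [DecidableEq β]

/-- The alternating sum `Σ_{F ⊆ G} (−1)^{|G \ F|} φ(F)`. -/
noncomputable def altSum {γ : Type*} [DecidableEq γ] (G : Finset γ) (φ : Finset γ → ℝ) : ℝ :=
  ∑ F ∈ G.powerset, (-1 : ℝ) ^ (G \ F).card * φ F

section AltSum

variable {γ : Type*} [DecidableEq γ]

lemma altSum_congr {G : Finset γ} {φ ψ : Finset γ → ℝ} (h : ∀ F ⊆ G, φ F = ψ F) :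
    altSum G φ = altSum G ψ :=
  Finset.sum_congr rfl fun F hF => by rw [h F (Finset.mem_powerset.1 hF)]

lemma altSum_empty (φ : Finset γ → ℝ) : altSum ∅ φ = φ ∅ := by simp [altSum]

lemma altSum_zero (G : Finset γ) : altSum G (fun _ => 0) = 0 := by simp [altSum]

lemma altSum_sum {ι : Type*} (G : Finset γ) (s : Finset ι) (φ : ι → Finset γ → ℝ) :
    altSum G (fun F => ∑ i ∈ s, φ i F) = ∑ i ∈ s, altSum G (φ i) := by
  simp only [altSum, Finset.mul_sum]
  exact Finset.sum_comm

lemma altSum_sub (G : Finset γ) (φ ψ : Finset γ → ℝ) :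
    altSum G (fun F => φ F - ψ F) = altSum G φ - altSum G ψ := by
  simp only [altSum, mul_sub, Finset.sum_sub_distrib]

lemma altSum_union {A B : Finset γ} (h : Disjoint A B) (φ : Finset γ → ℝ) :
    altSum (A ∪ B) φ = altSum A fun F₁ => altSum B fun F₂ => φ (F₁ ∪ F₂) := by
  simp only [altSum, Finset.mul_sum]
  rw [← Finset.sum_product']
  refine Finset.sum_nbij' (fun F => (F ∩ A, F ∩ B)) (fun p => p.1 ∪ p.2) ?_ ?_ ?_ ?_ ?_
  · intro F _
    simp
  · intro p hp
    simp only [Finset.mem_product, Finset.mem_powerset] at hp ⊢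
    exact Finset.union_subset_union hp.1 hp.2
  · intro F hF
    rw [Finset.mem_powerset] at hF
    rw [← Finset.inter_union_distrib_left, Finset.inter_eq_left.2 hF]
  · rintro ⟨p, q⟩ hp
    simp only [Finset.mem_product, Finset.mem_powerset] at hp
    have h1 : q ∩ A = ∅ := Finset.disjoint_iff_inter_eq_empty.1 (h.symm.mono_left hp.2)
    have h2 : p ∩ B = ∅ := Finset.disjoint_iff_inter_eq_empty.1 (h.mono_left hp.1)
    simp [Finset.union_inter_distrib_right, h1, h2, Finset.inter_eq_left.2 hp.1,
      Finset.inter_eq_left.2 hp.2]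
  · intro F hF
    rw [Finset.mem_powerset] at hF
    have e : (A ∪ B) \ F = (A \ (F ∩ A)) ∪ (B \ (F ∩ B)) := by
      ext x; simp only [Finset.mem_sdiff, Finset.mem_union, Finset.mem_inter]; tauto
    rw [e, Finset.card_union_of_disjoint (h.mono Finset.sdiff_subset Finset.sdiff_subset), pow_add,
      ← Finset.inter_union_distrib_left, Finset.inter_eq_left.2 hF, mul_assoc]

lemma altSum_mul {A B : Finset γ} (h : Disjoint A B) {φ φ₁ φ₂ : Finset γ → ℝ}
    (hφ : ∀ F₁ ⊆ A, ∀ F₂ ⊆ B, φ (F₁ ∪ F₂) = φ₁ F₁ * φ₂ F₂) :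
    altSum (A ∪ B) φ = altSum A φ₁ * altSum B φ₂ := by
  rw [altSum_union h, altSum_congr (ψ := fun F₁ => φ₁ F₁ * altSum B φ₂)]
  · simp only [altSum, Finset.sum_mul, mul_assoc]
  · intro F₁ h₁
    rw [altSum_congr fun F₂ h₂ => hφ F₁ h₁ F₂ h₂]
    simp only [altSum, Finset.mul_sum]
    exact Finset.sum_congr rfl fun _ _ => by ring

lemma altSum_subset (A B : Finset γ) :
    altSum A (fun F => if B ⊆ F then 1 else 0) = if B = A then 1 else 0 := by
  induction A using Finset.induction_on generalizing B with
  | empty => simp [altSum_empty, Finset.subset_empty]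
  | insert a A ha ih =>
    have hd : Disjoint ({a} : Finset γ) A := by simpa using ha
    rw [← Finset.singleton_union, altSum_union hd]
    have single : ∀ φ : Finset γ → ℝ, altSum {a} φ = φ {a} - φ ∅ := by
      intro φ
      have : ({a} : Finset γ).powerset = {∅, {a}} := by
        ext; simp [Finset.subset_singleton_iff]
      rw [altSum, this, Finset.sum_pair (Finset.singleton_ne_empty a).symm]
      simp
      ring
    rw [single]
    simp only [Finset.singleton_union, Finset.empty_union, Finset.subset_insert_iff]
    rw [ih, ih]
    by_cases haB : a ∈ B
    · have : B ≠ A := by rintro rfl; exact ha haB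
      rw [if_neg this]
      have : B.erase a = A ↔ B = insert a A := by
        constructor
        · rintro rfl; exact (Finset.insert_erase haB).symm
        · rintro rfl; exact Finset.erase_insert ha
      simp only [this, sub_zero]
      congr
    · rw [Finset.erase_eq_of_notMem haB]
      have : B ≠ insert a A := by rintro rfl; exact haB (Finset.mem_insert_self _ _)
      simp [this]

lemma altSum_one (A : Finset γ) : altSum A (fun _ => 1) = if A = ∅ then 1 else 0 := by
  simpa [eq_comm] using altSum_subset A ∅

end AltSum

/-- The rows `R` can be perfectly matched to the columns `C` by non-edges of `F`. -/
def AvoidingMatching (R : Finset α) (C : Finset β) (F : Finset (α × β)) : Prop :=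
  R.card = C.card ∧ ∃ f : α → β, Set.InjOn f R ∧ ∀ r ∈ R, f r ∈ C ∧ (r, f r) ∉ F

lemma AvoidingMatching.of_forall {α β : Type*} {R : Finset α} {C : Finset β} {F F' : Finset (α × β)}
    (h : ∀ r ∈ R, ∀ c ∈ C, (r, c) ∈ F' → (r, c) ∈ F) (hF : AvoidingMatching R C F) :
    AvoidingMatching R C F' := by
  obtain ⟨hc, f, hi, hf⟩ := hF
  exact ⟨hc, f, hi, fun r hr => ⟨(hf r hr).1, fun h' => (hf r hr).2 (h r hr _ (hf r hr).1 h')⟩⟩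

lemma avoidingMatching_congr {α β : Type*} {R : Finset α} {C : Finset β} {F F' : Finset (α × β)}
    (h : ∀ r ∈ R, ∀ c ∈ C, ((r, c) ∈ F ↔ (r, c) ∈ F')) :
    AvoidingMatching R C F ↔ AvoidingMatching R C F' :=
  ⟨.of_forall fun r hr c hc => (h r hr c hc).2, .of_forall fun r hr c hc => (h r hr c hc).1⟩

lemma avoidingMatching_of_hall {α : Type*} [Nonempty β] {R : Finset α} {C : Finset β}
    {F : Finset (α × β)}
    (hc : R.card = C.card) (N : α → Finset β)
    (hN : ∀ r ∈ R, ∀ c ∈ N r, c ∈ C ∧ (r, c) ∉ F)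
    (hall : ∀ s ⊆ R, s.card ≤ (s.biUnion N).card) : AvoidingMatching R C F := by
  classical
  obtain ⟨f, hf, hfN⟩ := (Finset.all_card_le_biUnion_card_iff_exists_injective
    fun r : R => N r).1 fun s => by
      have := hall (s.map (Function.Embedding.subtype _)) fun x hx => by
        obtain ⟨y, -, rfl⟩ := Finset.mem_map.1 hx
        exact y.2
      rwa [Finset.card_map, Finset.map_eq_image, Finset.image_biUnion] at this
  refine ⟨hc, fun r => if h : r ∈ R then f ⟨r, h⟩ else Classical.arbitrary β, ?_, ?_⟩
  · intro r hr s hs h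
    simp only [Finset.mem_coe] at hr hs
    simp only [hr, hs, dif_pos] at h
    exact congrArg Subtype.val (hf h)
  · intro r hr
    simp only [hr, dif_pos]
    exact hN r hr _ (hfN ⟨r, hr⟩)

lemma AvoidingMatching.union {R₁ R₂ : Finset α} {C₁ C₂ : Finset β} {F : Finset (α × β)}
    (hR : Disjoint R₁ R₂) (hC : Disjoint C₁ C₂) (h₁ : AvoidingMatching R₁ C₁ F)
    (h₂ : AvoidingMatching R₂ C₂ F) : AvoidingMatching (R₁ ∪ R₂) (C₁ ∪ C₂) F := by
  obtain ⟨e₁, f, hf, hf'⟩ := h₁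
  obtain ⟨e₂, g, hg, hg'⟩ := h₂
  have hne : ∀ r ∈ R₂, r ∉ R₁ := fun r h2 h1 => Finset.disjoint_left.1 hR h1 h2
  have hcne : ∀ r ∈ R₁, ∀ s ∈ R₂, f r ≠ g s := fun r hr s hs h =>
    Finset.disjoint_left.1 hC (hf' r hr).1 (h ▸ (hg' s hs).1)
  refine ⟨by rw [Finset.card_union_of_disjoint hR, Finset.card_union_of_disjoint hC, e₁, e₂],
    fun r => if r ∈ R₁ then f r else g r, ?_, ?_⟩
  · intro r hr s hs h
    simp only [Finset.coe_union, Set.mem_union, Finset.mem_coe] at hr hs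
    by_cases h1 : r ∈ R₁ <;> by_cases h2 : s ∈ R₁ <;> simp only [h1, h2, if_true, if_false] at h
    · exact hf h1 h2 h
    · exact absurd h (hcne r h1 s (hs.resolve_left h2))
    · exact absurd h.symm (hcne s h2 r (hr.resolve_left h1))
    · exact hg (hr.resolve_left h1) (hs.resolve_left h2) h
  · intro r hr
    by_cases h1 : r ∈ R₁
    · simp only [h1, if_true]
      exact ⟨Finset.mem_union_left _ (hf' r h1).1, (hf' r h1).2⟩
    · have h2 := (Finset.mem_union.1 hr).resolve_left h1
      simp only [h1, if_false]
      exact ⟨Finset.mem_union_right _ (hg' r h2).1, (hg' r h2).2⟩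

open scoped Classical in
/-- The columns whose removal from `C` leaves a set that can be matched to all of `R`. -/
noncomputable def missable (R : Finset α) (C : Finset β) (F : Finset (α × β)) : Finset β :=
  C.filter fun c => AvoidingMatching R (C.erase c) F

lemma mem_missable {α : Type*} {R : Finset α} {C : Finset β} {F : Finset (α × β)} {c : β} :
    c ∈ missable R C F ↔ c ∈ C ∧ AvoidingMatching R (C.erase c) F := by
  simp [missable]

lemma missable_subset {α : Type*} (R : Finset α) (C : Finset β) (F : Finset (α × β)) :
    missable R C F ⊆ C := fun _ h => (mem_missable.1 h).1

lemma missable_congr {α : Type*} {R : Finset α} {C : Finset β} {F F' : Finset (α × β)}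
    (h : ∀ r ∈ R, ∀ c ∈ C, ((r, c) ∈ F ↔ (r, c) ∈ F')) :
    missable R C F = missable R C F' := by
  ext c
  rw [mem_missable, mem_missable,
    avoidingMatching_congr fun r hr c hc => h r hr c (Finset.mem_of_mem_erase hc)]

lemma avoidingMatching_insert {R : Finset α} {C : Finset β} {F : Finset (α × β)} {r₀ : α}
    (h₀ : r₀ ∉ R) :
    AvoidingMatching (insert r₀ R) C F ↔ ∃ c ∈ missable R C F, (r₀, c) ∉ F := by
  constructor
  · rintro ⟨hc, f, hi, hf⟩
    have hm := hf r₀ (Finset.mem_insert_self _ _)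
    refine ⟨f r₀, mem_missable.2 ⟨hm.1, ?_, f, hi.mono (by simp), fun r hr => ?_⟩, hm.2⟩
    · rw [Finset.card_erase_of_mem hm.1, ← hc, Finset.card_insert_of_notMem h₀]; rfl
    · have := hf r (Finset.mem_insert_of_mem hr)
      refine ⟨Finset.mem_erase.2 ⟨fun h => ?_, this.1⟩, this.2⟩
      have := hi (by simp [hr]) (by simp) h
      exact h₀ (this ▸ hr)
  · rintro ⟨c, hc, hF⟩
    obtain ⟨hcC, h⟩ := mem_missable.1 hc
    have := AvoidingMatching.union (R₁ := {r₀}) (C₁ := {c}) (by simpa using h₀) (by simp)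
      ⟨by simp, fun _ => c, by simp, by simpa using hF⟩ h
    rwa [Finset.singleton_union, Finset.singleton_union, Finset.insert_erase hcC] at this

/-- Exchange property: a row with an available missable column is always matched
to a missable column. -/
lemma mem_missable_of_matching [Nonempty β] {R : Finset α} {C : Finset β} {F : Finset (α × β)}
    {f : α → β} (hcard : R.card + 1 = C.card) (hi : Set.InjOn f R)
    (hf : ∀ r ∈ R, f r ∈ C ∧ (r, f r) ∉ F) {r : α} (hr : r ∈ R) {c : β}
    (hc : c ∈ missable R C F) (hrc : (r, c) ∉ F) : f r ∈ missable R C F := by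
  by_contra hmiss
  obtain ⟨hcC, -, g, hgi, hg⟩ := mem_missable.1 hc
  refine hmiss (mem_missable.2 ⟨(hf r hr).1, avoidingMatching_of_hall
    (by rw [Finset.card_erase_of_mem (hf r hr).1]; omega)
    (fun s => (C.erase (f r)).filter fun x => (s, x) ∉ F) (by simp +contextual) ?_⟩)
  intro s hs
  by_contra! hlt
  set N : Finset β := s.biUnion fun a => C.filter fun x => (a, x) ∉ F with hN
  have hNe : (s.biUnion fun a => (C.erase (f r)).filter fun x => (a, x) ∉ F) = N.erase (f r) := by
    ext x; simp only [hN, Finset.mem_biUnion, Finset.mem_filter, Finset.mem_erase]; tauto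
  rw [hNe] at hlt
  have hfs : s.image f ⊆ N := by
    intro x hx
    obtain ⟨a, ha, rfl⟩ := Finset.mem_image.1 hx
    exact Finset.mem_biUnion.2 ⟨a, ha, by simpa using hf a (hs ha)⟩
  have hcs : (s.image f).card = s.card := Finset.card_image_of_injOn (hi.mono (by simpa using hs))
  have hle := Finset.card_le_card hfs
  have hpe := Finset.pred_card_le_card_erase (s := N) (a := f r)
  have hfr : f r ∈ N := by
    by_contra h
    rw [Finset.erase_eq_of_notMem h] at hlt
    omega
  rw [Finset.card_erase_of_mem hfr] at hlt
  have hrs : r ∈ s := by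
    have : s.image f = N := Finset.eq_of_subset_of_card_le hfs (by omega)
    rw [← this] at hfr
    obtain ⟨a, ha, hae⟩ := Finset.mem_image.1 hfr
    rwa [← hi (hs ha) hr hae]
  have hcN : c ∈ N := Finset.mem_biUnion.2 ⟨r, hrs, by simp [hcC, hrc]⟩
  have hgs : s.image g ⊆ N.erase c := by
    intro x hx
    obtain ⟨a, ha, rfl⟩ := Finset.mem_image.1 hx
    have := hg a (hs ha)
    rw [Finset.mem_erase] at this
    exact Finset.mem_erase.2 ⟨this.1.1, Finset.mem_biUnion.2 ⟨a, ha, by simp [this]⟩⟩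
  have h1 := Finset.card_le_card hgs
  rw [Finset.card_image_of_injOn (hgi.mono (by simpa using hs)), Finset.card_erase_of_mem hcN] at h1
  omega

/-- The rows `Z` and columns `D` split off the part of the complement of `F` that carries the
missable columns. -/
def Splits (R : Finset α) (C D : Finset β) (F : Finset (α × β)) (Z : Finset α) : Prop :=
  (R \ Z) ×ˢ D ⊆ F ∧ missable Z D F = D ∧ AvoidingMatching (R \ Z) (C \ D) F

lemma Splits.missable_eq {R Z : Finset α} {C D : Finset β} {F : Finset (α × β)} (hZ : Z ⊆ R)
    (hD : D ⊆ C) (h : Splits R C D F Z) : missable R C F = D := by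
  obtain ⟨h1, h2, h3⟩ := h
  ext c
  rw [mem_missable]
  constructor
  · rintro ⟨hcC, -, f, hi, hf⟩
    by_contra hcD
    have : ((R \ Z).image f) ⊆ (C \ D).erase c := by
      intro x hx
      obtain ⟨a, ha, rfl⟩ := Finset.mem_image.1 hx
      have := hf a (Finset.mem_sdiff.1 ha).1
      rw [Finset.mem_erase] at this
      refine Finset.mem_erase.2 ⟨this.1.1, Finset.mem_sdiff.2 ⟨this.1.2, fun hx => this.2 (h1 ?_)⟩⟩
      exact Finset.mem_product.2 ⟨ha, hx⟩
    have hle := Finset.card_le_card this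
    have hcm : c ∈ C \ D := Finset.mem_sdiff.2 ⟨hcC, hcD⟩
    rw [Finset.card_image_of_injOn (hi.mono (by simp)), Finset.card_erase_of_mem hcm, h3.1] at hle
    have := Finset.card_pos.2 ⟨c, hcm⟩
    omega
  · intro hcD
    have := (mem_missable.1 (h2.symm ▸ hcD)).2
    have hu := this.union Finset.disjoint_sdiff
      (Finset.disjoint_sdiff.mono_left (Finset.erase_subset c D)) h3
    refine ⟨hD hcD, ?_⟩
    rw [Finset.union_sdiff_of_subset hZ] at hu
    convert hu using 1
    ext x
    simp only [Finset.mem_erase, Finset.mem_union, Finset.mem_sdiff]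
    constructor
    · tauto
    · rintro (h | h)
      · exact ⟨h.1, hD h.2⟩
      · exact ⟨fun e => h.2 (e ▸ hcD), h.1⟩

lemma Splits.eq_filter {R Z : Finset α} {C D : Finset β} {F : Finset (α × β)} (hZ : Z ⊆ R)
    (hne : D.Nonempty) (h : Splits R C D F Z) : Z = R.filter fun r => ∃ c ∈ D, (r, c) ∉ F := by
  obtain ⟨h1, h2, -⟩ := h
  ext r
  rw [Finset.mem_filter]
  constructor
  · intro hr
    obtain ⟨c, hc⟩ := hne
    obtain ⟨-, -, f, -, hf⟩ := mem_missable.1 (h2.symm ▸ hc)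
    exact ⟨hZ hr, f r, Finset.mem_of_mem_erase (hf r hr).1, (hf r hr).2⟩
  · rintro ⟨hr, c, hc, hF⟩
    by_contra hrZ
    exact hF (h1 (by simp [hr, hrZ, hc]))

lemma splits_of_missable_eq [Nonempty β] {R : Finset α} {C D : Finset β} {F : Finset (α × β)}
    (hne : D.Nonempty) (h : missable R C F = D) :
    Splits R C D F (R.filter fun r => ∃ c ∈ D, (r, c) ∉ F) := by
  set Z := R.filter fun r => ∃ c ∈ D, (r, c) ∉ F with hZ
  have hDC : D ⊆ C := h ▸ missable_subset R C F
  have hZR : Z ⊆ R := Finset.filter_subset _ R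
  have h1 : (R \ Z) ×ˢ D ⊆ F := by
    rintro ⟨r, c⟩ hrc
    simp only [hZ, Finset.mem_product, Finset.mem_sdiff, Finset.mem_filter, not_and, not_exists,
      not_not] at hrc
    exact hrc.1.2 hrc.1.1 c hrc.2
  have key : ∀ c ∈ D, AvoidingMatching Z (D.erase c) F ∧ AvoidingMatching (R \ Z) (C \ D) F := by
    intro c hc
    obtain ⟨hcC, hcard, f, hi, hf⟩ := mem_missable.1 (h.symm ▸ hc)
    have hf' : ∀ r ∈ R, f r ∈ C ∧ (r, f r) ∉ F :=
      fun r hr => ⟨Finset.mem_of_mem_erase (hf r hr).1, (hf r hr).2⟩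
    have hcpos := Finset.card_pos.2 ⟨c, hcC⟩
    rw [Finset.card_erase_of_mem hcC] at hcard
    have hZD : ∀ r ∈ Z, f r ∈ D.erase c ∧ (r, f r) ∉ F := by
      intro r hr
      obtain ⟨hrR, x, hx, hxF⟩ := Finset.mem_filter.1 hr
      have := mem_missable_of_matching (by omega) hi hf' hrR (h.symm ▸ hx) hxF
      rw [h] at this
      exact ⟨Finset.mem_erase.2 ⟨Finset.ne_of_mem_erase (hf r hrR).1, this⟩, (hf r hrR).2⟩
    have hZc : ∀ r ∈ R \ Z, f r ∈ C \ D ∧ (r, f r) ∉ F := by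
      intro r hr
      have hrR := (Finset.mem_sdiff.1 hr).1
      exact ⟨Finset.mem_sdiff.2 ⟨(hf' r hrR).1, fun hx => (hf' r hrR).2 (h1 (by
        exact Finset.mem_product.2 ⟨hr, hx⟩))⟩, (hf' r hrR).2⟩
    have hiZ : Set.InjOn f Z := hi.mono (by exact_mod_cast hZR)
    have hiZc : Set.InjOn f (R \ Z : Finset α) := hi.mono (by simp)
    have c1 : Z.card ≤ (D.erase c).card :=
      Finset.card_le_card_of_injOn f (fun r hr => (hZD r hr).1) hiZ
    have c2 : (R \ Z).card ≤ (C \ D).card :=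
      Finset.card_le_card_of_injOn f (fun r hr => (hZc r hr).1) hiZc
    have c3 := Finset.card_sdiff_add_card_eq_card hZR
    have c4 := Finset.card_sdiff_add_card_eq_card hDC
    have c5 := Finset.card_erase_of_mem hc
    have c6 := Finset.card_pos.2 ⟨c, hc⟩
    exact ⟨⟨by omega, f, hiZ, hZD⟩, ⟨by omega, f, hiZc, hZc⟩⟩
  refine ⟨h1, ?_, ?_⟩
  · ext c
    exact ⟨fun hc => (mem_missable.1 hc).1, fun hc => mem_missable.2 ⟨hc, (key c hc).1⟩⟩
  · obtain ⟨c, hc⟩ := hne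
    exact (key c hc).2

open scoped Classical in
/-- Alternating sum of the obstruction indicator over the part of `G` inside `R × C`. -/
noncomputable def obstructedSum (R : Finset α) (C : Finset β) (G : Finset (α × β)) : ℝ :=
  altSum (G ∩ R ×ˢ C) fun F => if AvoidingMatching R C F then 0 else 1

open scoped Classical in
/-- Alternating sum of the matchability indicator over the part of `G` inside `R × C`. -/
noncomputable def matchedSum (R : Finset α) (C : Finset β) (G : Finset (α × β)) : ℝ :=
  altSum (G ∩ R ×ˢ C) fun F => if AvoidingMatching R C F then 1 else 0

/-- Alternating sum of the indicator that `D` is the set of missable columns. -/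
noncomputable def missableSum (R : Finset α) (C : Finset β) (G : Finset (α × β))
    (D : Finset β) : ℝ :=
  altSum (G ∩ R ×ˢ C) fun F => if missable R C F = D then 1 else 0

lemma matchedSum_eq (R : Finset α) (C : Finset β) (G : Finset (α × β)) :
    matchedSum R C G = (if G ∩ R ×ˢ C = ∅ then 1 else 0) - obstructedSum R C G := by
  rw [← altSum_one, obstructedSum, ← altSum_sub]
  exact altSum_congr fun F _ => by split_ifs <;> simp

lemma inter_product_congr {R : Finset α} {C : Finset β} {G G' : Finset (α × β)}
    (h : ∀ r ∈ R, ∀ c ∈ C, ((r, c) ∈ G ↔ (r, c) ∈ G')) : G ∩ R ×ˢ C = G' ∩ R ×ˢ C := by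
  ext ⟨r, c⟩
  simp only [Finset.mem_inter, Finset.mem_product]
  exact and_congr_left fun hrc => h r hrc.1 c hrc.2

lemma missableSum_congr {R : Finset α} {C : Finset β} {G G' : Finset (α × β)} (D : Finset β)
    (h : ∀ r ∈ R, ∀ c ∈ C, ((r, c) ∈ G ↔ (r, c) ∈ G')) :
    missableSum R C G D = missableSum R C G' D := by
  rw [missableSum, missableSum, inter_product_congr h]

lemma obstructedSum_insert {R : Finset α} (C : Finset β) (G : Finset (α × β)) {r₀ : α}
    (h₀ : r₀ ∉ R) :
    obstructedSum (insert r₀ R) C G = missableSum R C G (C.filter fun c => (r₀, c) ∈ G) := by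
  classical
  set D := C.filter fun c => (r₀, c) ∈ G with hD
  have hG : G ∩ (insert r₀ R) ×ˢ C = (G ∩ R ×ˢ C) ∪ {r₀} ×ˢ D := by
    ext ⟨r, c⟩
    simp only [hD, Finset.mem_inter, Finset.mem_product, Finset.mem_insert, Finset.mem_union,
      Finset.mem_singleton, Finset.mem_filter]
    constructor
    · rintro ⟨hG, rfl | hr, hc⟩ <;> tauto
    · rintro (h | ⟨rfl, h⟩) <;> tauto
  have hdisj : Disjoint (G ∩ R ×ˢ C) ({r₀} ×ˢ D) := by
    rw [Finset.disjoint_left]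
    rintro ⟨r, c⟩ h1 h2
    simp only [Finset.mem_inter, Finset.mem_product, Finset.mem_singleton] at h1 h2
    exact h₀ (h2.1 ▸ h1.2.1)
  rw [obstructedSum, missableSum, hG, altSum_union hdisj]
  refine altSum_congr fun F₁ h₁ => ?_
  have hr₀ : ∀ c, (r₀, c) ∉ F₁ := fun c hc => by
    have := h₁ hc
    simp [h₀] at this
  have hi : ∀ X : Finset β, ({r₀} ×ˢ X : Finset (α × β)) = {r₀} ×ˢ D ↔ X = D := by
    intro X
    constructor
    · intro h
      ext c
      simpa using Finset.ext_iff.1 h (r₀, c)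
    · rintro rfl; rfl
  have := altSum_subset ({r₀} ×ˢ D) ({r₀} ×ˢ missable R C F₁)
  simp only [hi] at this
  rw [← this]
  refine altSum_congr fun F₂ h₂ => ?_
  have hm : missable R C (F₁ ∪ F₂) = missable R C F₁ := by
    refine missable_congr fun r hr c _ => ?_
    rw [Finset.mem_union, or_iff_left]
    intro h
    have := h₂ h
    simp only [Finset.mem_product, Finset.mem_singleton] at this
    exact h₀ (this.1 ▸ hr)
  have hs : {r₀} ×ˢ missable R C F₁ ⊆ F₂ ↔ ¬ AvoidingMatching (insert r₀ R) C (F₁ ∪ F₂) := by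
    rw [avoidingMatching_insert h₀, hm]
    push Not
    constructor
    · intro h c hc
      exact Finset.mem_union_right _ (h (by simp [hc]))
    · rintro h ⟨r, c⟩ hrc
      simp only [Finset.mem_product, Finset.mem_singleton] at hrc
      rw [hrc.1]
      exact (Finset.mem_union.1 (h c hrc.2)).resolve_left (hr₀ c)
  by_cases h : AvoidingMatching (insert r₀ R) C (F₁ ∪ F₂)
  · rw [if_pos h, if_neg fun h' => hs.1 h' h]
  · rw [if_neg h, if_pos (hs.2 h)]

lemma sum_missableSum (R : Finset α) (C : Finset β) (G : Finset (α × β)) :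
    ∑ D ∈ C.powerset, missableSum R C G D = if G ∩ R ×ˢ C = ∅ then 1 else 0 := by
  simp only [missableSum]
  rw [← altSum_sum, ← altSum_one]
  refine altSum_congr fun F _ => ?_
  rw [Finset.sum_ite_eq, if_pos (Finset.mem_powerset.2 (missable_subset R C F))]

/-- The alternating sum of the missable-column indicator factors over the possible splittings. -/
lemma missableSum_eq_sum [Nonempty β] (R : Finset α) {C D : Finset β} (G : Finset (α × β))
    (hD : D ⊆ C) (hne : D.Nonempty) :
    missableSum R C G D =
      ∑ Z ∈ R.powerset with (R \ Z) ×ˢ D ⊆ G ∧ G ∩ Z ×ˢ (C \ D) = ∅,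
        missableSum Z D G D * matchedSum (R \ Z) (C \ D) G := by
  classical
  have hind : ∀ F : Finset (α × β), (if missable R C F = D then (1 : ℝ) else 0) =
      ∑ Z ∈ R.powerset, if Splits R C D F Z then 1 else 0 := by
    intro F
    split_ifs with h
    · rw [Finset.sum_eq_single_of_mem (R.filter fun r => ∃ c ∈ D, (r, c) ∉ F)
        (Finset.mem_powerset.2 (Finset.filter_subset _ _)), if_pos (splits_of_missable_eq hne h)]
      intro Z hZ hZne
      exact if_neg fun hs => hZne (hs.eq_filter (Finset.mem_powerset.1 hZ) hne)
    · exact (Finset.sum_eq_zero fun Z hZ =>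
        if_neg fun hs => h (hs.missable_eq (Finset.mem_powerset.1 hZ) hD)).symm
  rw [missableSum, altSum_congr fun F _ => hind F, altSum_sum, Finset.sum_filter]
  refine Finset.sum_congr rfl fun Z hZ => ?_
  rw [Finset.mem_powerset] at hZ
  have hG : G ∩ R ×ˢ C = ((G ∩ Z ×ˢ D) ∪ (G ∩ (R \ Z) ×ˢ (C \ D))) ∪
      ((G ∩ (R \ Z) ×ˢ D) ∪ (G ∩ Z ×ˢ (C \ D))) := by
    ext ⟨r, c⟩
    simp only [Finset.mem_inter, Finset.mem_union, Finset.mem_product, Finset.mem_sdiff]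
    have := @hZ r
    have := @hD c
    tauto
  have hdisj : ∀ {X X' : Finset α} {Y Y' : Finset β}, Disjoint X X' ∨ Disjoint Y Y' →
      Disjoint (G ∩ X ×ˢ Y) (G ∩ X' ×ˢ Y') := fun h =>
    (Finset.disjoint_product.2 h).mono Finset.inter_subset_right Finset.inter_subset_right
  have hdR : Disjoint Z (R \ Z) := Finset.disjoint_sdiff
  have hdC : Disjoint D (C \ D) := Finset.disjoint_sdiff
  rw [hG, altSum_mul (φ₁ := fun F => (if missable Z D F = D then 1 else 0) *
      (if AvoidingMatching (R \ Z) (C \ D) F then 1 else 0))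
      (φ₂ := fun F => if (R \ Z) ×ˢ D ⊆ F then 1 else 0),
    altSum_mul (φ₁ := fun F => if missable Z D F = D then 1 else 0)
      (φ₂ := fun F => if AvoidingMatching (R \ Z) (C \ D) F then 1 else 0),
    altSum_mul (φ₁ := fun F => if (R \ Z) ×ˢ D ⊆ F then 1 else 0) (φ₂ := fun _ => 1)]
  · have hsub : (R \ Z) ×ˢ D = G ∩ (R \ Z) ×ˢ D ↔ (R \ Z) ×ˢ D ⊆ G := by
      rw [eq_comm, Finset.inter_eq_right]
    rw [altSum_subset, altSum_one, ite_and, missableSum, matchedSum]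
    simp only [hsub]
    split_ifs <;> simp
  · exact hdisj (Or.inl hdR.symm)
  · intro F₁ _ F₂ h₂
    rw [mul_one]
    have : (R \ Z) ×ˢ D ⊆ F₁ ∪ F₂ ↔ (R \ Z) ×ˢ D ⊆ F₁ := by
      refine ⟨fun h x hx => (Finset.mem_union.1 (h hx)).resolve_right fun hx2 => ?_,
        fun h => h.trans Finset.subset_union_left⟩
      have := h₂ hx2
      simp only [Finset.mem_inter, Finset.mem_product, Finset.mem_sdiff] at this hx
      tauto
    simp only [this]
  · exact hdisj (Or.inl hdR)
  · intro F₁ h₁ F₂ h₂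
    rw [missable_congr (F' := F₁), avoidingMatching_congr (F' := F₂)]
    · intro r hr c hc
      rw [Finset.mem_union, or_iff_right]
      intro h
      have := h₁ h
      simp only [Finset.mem_inter, Finset.mem_product, Finset.mem_sdiff] at this hr
      tauto
    · intro r hr c hc
      rw [Finset.mem_union, or_iff_left]
      intro h
      have := h₂ h
      simp only [Finset.mem_inter, Finset.mem_product, Finset.mem_sdiff] at this hr
      tauto
  · exact Finset.disjoint_union_left.2 ⟨Finset.disjoint_union_right.2
      ⟨hdisj (Or.inl hdR), hdisj (Or.inr hdC)⟩, Finset.disjoint_union_right.2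
      ⟨hdisj (Or.inr hdC.symm), hdisj (Or.inl hdR.symm)⟩⟩
  · intro F₁ h₁ F₂ h₂
    have e1 : missable Z D (F₁ ∪ F₂) = missable Z D F₁ := by
      refine missable_congr fun r hr c hc => ?_
      rw [Finset.mem_union, or_iff_left]
      intro h
      have := h₂ h
      simp only [Finset.mem_union, Finset.mem_inter, Finset.mem_product, Finset.mem_sdiff] at this
      tauto
    have e2 : AvoidingMatching (R \ Z) (C \ D) (F₁ ∪ F₂) ↔
        AvoidingMatching (R \ Z) (C \ D) F₁ := by
      refine avoidingMatching_congr fun r hr c hc => ?_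
      rw [Finset.mem_union, or_iff_left]
      intro h
      have := h₂ h
      simp only [Finset.mem_union, Finset.mem_inter, Finset.mem_product,
        Finset.mem_sdiff] at this hr hc
      tauto
    have e3 : (R \ Z) ×ˢ D ⊆ F₁ ∪ F₂ ↔ (R \ Z) ×ˢ D ⊆ F₂ := by
      refine ⟨fun h x hx => (Finset.mem_union.1 (h hx)).resolve_left fun hx1 => ?_,
        fun h => h.trans Finset.subset_union_right⟩
      have := h₁ hx1
      simp only [Finset.mem_union, Finset.mem_inter, Finset.mem_product,
        Finset.mem_sdiff] at this hx
      tauto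
    simp only [Splits, e1, e2, e3]
    split_ifs <;> simp_all


lemma missableSum_eq_zero {R : Finset α} {C D : Finset β} (G : Finset (α × β))
    (hne : D.Nonempty) (h : R.card + 1 ≠ C.card) : missableSum R C G D = 0 := by
  refine (altSum_congr fun F _ => if_neg fun hF => h ?_).trans (altSum_zero _)
  obtain ⟨c, hc⟩ := hne
  obtain ⟨hcC, hcard, -⟩ := mem_missable.1 (hF.symm ▸ hc)
  rw [hcard, Finset.card_erase_add_one hcC]

lemma avoidingMatching_of_forall_notMem {α β : Type*} [Nonempty β] {R : Finset α} {C : Finset β}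
    {F : Finset (α × β)} (hc : R.card = C.card) (hF : ∀ r ∈ R, ∀ c ∈ C, (r, c) ∉ F) :
    AvoidingMatching R C F := by
  classical
  refine avoidingMatching_of_hall hc (fun _ => C) (fun r hr c hc => ⟨hc, hF r hr c hc⟩) ?_
  intro s hs
  rcases s.eq_empty_or_nonempty with rfl | ⟨a, ha⟩
  · simp
  · exact ((Finset.card_le_card hs).trans hc.le).trans
      (Finset.card_le_card fun x hx => Finset.mem_biUnion.2 ⟨a, ha, hx⟩)

lemma missableSum_of_inter_eq_empty [Nonempty β] {R : Finset α} {C : Finset β}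
    {G : Finset (α × β)} (hne : C.Nonempty) (hG : G ∩ R ×ˢ C = ∅) :
    missableSum R C G C = if R.card + 1 = C.card then 1 else 0 := by
  split_ifs with h
  · rw [missableSum, hG, altSum_empty, if_pos]
    refine (missable_subset R C ∅).antisymm fun c hc => mem_missable.2 ⟨hc, ?_⟩
    exact avoidingMatching_of_forall_notMem (by rw [Finset.card_erase_of_mem hc]; omega) (by simp)
  · exact missableSum_eq_zero G hne h

lemma obstructedSum_of_inter_eq_empty [Nonempty β] {R : Finset α} {C : Finset β}
    {G : Finset (α × β)} (hc : R.card = C.card) (hG : G ∩ R ×ˢ C = ∅) :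
    obstructedSum R C G = 0 := by
  rw [obstructedSum, hG, altSum_empty,
    if_pos (avoidingMatching_of_forall_notMem hc (by simp))]

lemma inter_product_eq_empty_iff {R : Finset α} {C : Finset β} {G : Finset (α × β)} :
    G ∩ R ×ˢ C = ∅ ↔ ∀ r ∈ R, ∀ c ∈ C, (r, c) ∉ G := by
  simp only [Finset.eq_empty_iff_forall_notMem, Finset.mem_inter, Finset.mem_product, Prod.forall]
  exact ⟨fun h r hr c hc hG => h r c ⟨hG, hr, hc⟩, fun h r c hrc => h r hrc.2.1 c hrc.2.2 hrc.1⟩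

/-- The intermediate terms in the expansion of a graph that is complete outside a set `E` of
isolated rows. -/
lemma missableSum_block_of_ssubset [Nonempty β] {R E : Finset α} {C D : Finset β}
    {G : Finset (α × β)} (hE : E ⊆ R) (hempty : ∀ r ∈ E, ∀ c ∈ C, (r, c) ∉ G)
    (hfull : ∀ r ∈ R \ E, ∀ c ∈ C, (r, c) ∈ G) (hne : D.Nonempty) (hD : D ⊂ C) :
    missableSum R C G D =
      if E.card + 1 = D.card then matchedSum (R \ E) (C \ D) G else 0 := by
  have hCD : ∃ c ∈ C, c ∉ D := Finset.exists_of_ssubset hD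
  have hset : (R.powerset.filter fun Z => (R \ Z) ×ˢ D ⊆ G ∧ G ∩ Z ×ˢ (C \ D) = ∅) = {E} := by
    ext Z
    simp only [Finset.mem_filter, Finset.mem_powerset, Finset.mem_singleton,
      inter_product_eq_empty_iff]
    constructor
    · rintro ⟨hZ, h1, h2⟩
      ext r
      constructor
      · intro hr
        by_contra hrE
        obtain ⟨c, hc, hcD⟩ := hCD
        exact h2 r hr c (Finset.mem_sdiff.2 ⟨hc, hcD⟩)
          (hfull r (Finset.mem_sdiff.2 ⟨hZ hr, hrE⟩) c hc)
      · intro hr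
        by_contra hrZ
        obtain ⟨c, hc⟩ := hne
        exact hempty r hr c (hD.1 hc) (h1 (by simp [hE hr, hrZ, hc]))
    · rintro rfl
      refine ⟨hE, ?_, fun r hr c hc => hempty r hr c (Finset.mem_sdiff.1 hc).1⟩
      rintro ⟨r, c⟩ hrc
      rw [Finset.mem_product] at hrc
      exact hfull r hrc.1 c (hD.1 hrc.2)
  rw [missableSum_eq_sum R G hD.1 hne, hset, Finset.sum_singleton,
    missableSum_of_inter_eq_empty hne]
  · split_ifs <;> simp
  · exact inter_product_eq_empty_iff.2 fun r hr c hc => hempty r hr c (hD.1 hc)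

/-- A square graph consisting of isolated rows `E` and full rows. -/
lemma obstructedSum_block [Nonempty β] {R E : Finset α} {C : Finset β} {G : Finset (α × β)}
    (hne : C.Nonempty) (hcard : R.card = C.card) (hE : E ⊆ R)
    (hempty : ∀ r ∈ E, ∀ c ∈ C, (r, c) ∉ G) (hfull : ∀ r ∈ R \ E, ∀ c ∈ C, (r, c) ∈ G) :
    obstructedSum R C G = (C.card - 1).choose E.card := by
  induction hq : R.card using Nat.strong_induction_on generalizing R E C G with
  | _ q ihq =>
  induction hm : (R \ E).card generalizing E G with
  | zero =>
    have hRE : R = E := by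
      rw [Finset.card_eq_zero, Finset.sdiff_eq_empty_iff_subset] at hm
      exact hm.antisymm hE
    subst hRE
    have := Finset.card_pos.2 hne
    rw [obstructedSum_of_inter_eq_empty hcard (inter_product_eq_empty_iff.2 hempty),
      Nat.choose_eq_zero_of_lt (by omega), Nat.cast_zero]
  | succ m ihm =>
    obtain ⟨r₀, hr₀⟩ : (R \ E).Nonempty := Finset.card_pos.1 (by omega)
    have hr₀' := Finset.mem_sdiff.1 hr₀
    set R' := R.erase r₀ with hR'
    have hins : insert r₀ R' = R := Finset.insert_erase hr₀'.1
    have hnot : r₀ ∉ R' := Finset.notMem_erase r₀ R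
    have hR'c : R'.card + 1 = C.card := by rw [← hcard]; exact Finset.card_erase_add_one hr₀'.1
    have hER' : E ⊆ R' := fun r hr =>
      Finset.mem_erase.2 ⟨fun h => hr₀'.2 (h ▸ hr), hE hr⟩
    have hfull' : ∀ r ∈ R' \ E, ∀ c ∈ C, (r, c) ∈ G := fun r hr =>
      hfull r (Finset.sdiff_subset_sdiff (Finset.erase_subset _ _) subset_rfl hr)
    have hEm := Finset.card_sdiff_add_card_eq_card hE
    have hEm' := Finset.card_sdiff_add_card_eq_card hER'
    have hfullD : missableSum R' C G C = obstructedSum R C G := by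
      rw [← hins, obstructedSum_insert C G hnot,
        Finset.filter_true_of_mem fun c hc => hfull r₀ hr₀ c hc]
    have hemptyD : missableSum R' C G ∅ = (C.card - 1).choose (E.card + 1) := by
      have hG' : ∀ r ∈ R', ∀ c ∈ C, ((r, c) ∈ G ↔ (r, c) ∈ G \ {r₀} ×ˢ C) := by
        intro r hr c _
        have : r ≠ r₀ := Finset.ne_of_mem_erase hr
        simp [this.symm]
      have := ihm (E := insert r₀ E) (G := G \ {r₀} ×ˢ C)
        (Finset.insert_subset hr₀'.1 hE) ?_ ?_ ?_
      · rw [← hins, obstructedSum_insert C _ hnot, Finset.card_insert_of_notMem hr₀'.2] at this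
        rw [missableSum_congr ∅ hG', ← this]
        congr 1
        ext c
        simp +contextual
      · intro r hr c hc
        rcases Finset.mem_insert.1 hr with rfl | hr
        · simp [hc]
        · simp [hempty r hr c hc]
      · intro r hr c hc
        simp only [Finset.mem_sdiff, Finset.mem_insert, not_or] at hr
        simp [Ne.symm hr.2.1, hfull r (Finset.mem_sdiff.2 ⟨hr.1, hr.2.2⟩) c hc]
      · have := Finset.card_sdiff_add_card_eq_card (Finset.insert_subset hr₀'.1 hE)
        rw [Finset.card_insert_of_notMem hr₀'.2] at this
        omega
    have hsum := sum_missableSum R' C G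
    rw [← Finset.sum_erase_add _ _ (Finset.mem_powerset_self C), ← Finset.sum_erase_add _ _
      (Finset.mem_erase.2 ⟨hne.ne_empty.symm, Finset.empty_mem_powerset C⟩),
      hfullD, hemptyD] at hsum
    have hmid : ∀ D ∈ (C.powerset.erase C).erase ∅, missableSum R' C G D =
        if E.card + 1 = D.card then -1 else 0 := by
      intro D hD
      simp only [Finset.mem_erase, Finset.mem_powerset] at hD
      have hDne := Finset.nonempty_iff_ne_empty.2 hD.1
      have hDC : D ⊂ C := Finset.ssubset_iff_subset_ne.2 ⟨hD.2.2, hD.2.1⟩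
      rw [missableSum_block_of_ssubset hER' hempty hfull' hDne hDC]
      split_ifs with h
      · have hlt := Finset.card_lt_card hDC
        have hCD := Finset.card_sdiff_add_card_eq_card hD.2.2
        have hne' : (C \ D).Nonempty := Finset.card_pos.1 (by omega)
        have hfull'' : ∀ r ∈ R' \ E, ∀ c ∈ C \ D, (r, c) ∈ G := fun r hr c hc =>
          hfull' r hr c (Finset.mem_sdiff.1 hc).1
        have := ihq (R' \ E).card (by omega) (R := R' \ E) (E := ∅) (C := C \ D) (G := G) hne'
          (by omega) (Finset.empty_subset _) (by simp) (by simpa using hfull'') rfl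
        rw [matchedSum_eq, this, if_neg]
        · simp
        · obtain ⟨c, hc⟩ := hne'
          obtain ⟨r, hr⟩ : (R' \ E).Nonempty := Finset.card_pos.1 (by omega)
          exact fun h0 => inter_product_eq_empty_iff.1 h0 r hr c hc (hfull'' r hr c hc)
      · rfl
    rw [Finset.sum_congr rfl hmid] at hsum
    have hpas : (C.card.choose (E.card + 1) : ℝ) =
        (C.card - 1).choose E.card + (C.card - 1).choose (E.card + 1) := by
      rw [← Nat.cast_add, ← Nat.choose_succ_succ, show (C.card - 1).succ = C.card by omega]
    rcases Nat.eq_zero_or_pos m with rfl | hmpos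
    · have hRE : G ∩ R' ×ˢ C = ∅ := by
        have : E = R' := Finset.eq_of_subset_of_card_le hER' (by omega)
        rw [← this]
        exact inter_product_eq_empty_iff.2 hempty
      rw [if_pos hRE, Finset.sum_eq_zero] at hsum
      · rw [Nat.choose_eq_zero_of_lt (by omega : C.card - 1 < E.card + 1)] at hsum
        rw [show C.card - 1 = E.card by omega, Nat.choose_self]
        simpa using hsum
      · intro D hD
        simp only [Finset.mem_erase, Finset.mem_powerset] at hD
        have := Finset.card_lt_card (Finset.ssubset_iff_subset_ne.2 ⟨hD.2.2, hD.2.1⟩)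
        exact if_neg (by omega)
    · have hRE : G ∩ R' ×ˢ C ≠ ∅ := by
        obtain ⟨c, hc⟩ := hne
        obtain ⟨r, hr⟩ : (R' \ E).Nonempty := Finset.card_pos.1 (by omega)
        exact fun h0 => inter_product_eq_empty_iff.1 h0 r (Finset.mem_sdiff.1 hr).1 c hc
          (hfull' r hr c hc)
      have hfil : ((C.powerset.erase C).erase ∅).filter (fun D => E.card + 1 = D.card) =
          C.powersetCard (E.card + 1) := by
        ext D
        simp only [Finset.mem_filter, Finset.mem_erase, Finset.mem_powerset,
          Finset.mem_powersetCard]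
        constructor
        · rintro ⟨⟨-, -, h⟩, h'⟩
          exact ⟨h, h'.symm⟩
        · rintro ⟨h, h'⟩
          refine ⟨⟨?_, ?_, h⟩, h'.symm⟩
          · rintro rfl; simp at h'
          · rintro rfl; omega
      rw [if_neg hRE, ← Finset.sum_filter, hfil, Finset.sum_const, Finset.card_powersetCard,
        nsmul_eq_mul, hpas] at hsum
      linarith

/-- Peeling off the smallest nonempty rows `B`, with common neighbourhood `D`, of a nested graph
whose isolated rows are `E`. -/
lemma obstructedSum_peel [Nonempty β] {R E B : Finset α} {C D : Finset β} {G : Finset (α × β)}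
    {s : ℝ} (hE : E ⊆ R) (hB : B ⊆ R) (hEB : Disjoint E B) (hBne : B.Nonempty)
    (hD : D ⊆ C) (hDne : D.Nonempty)
    (hGE : ∀ r ∈ E, ∀ c ∈ C, (r, c) ∉ G) (hGB : ∀ r ∈ B, ∀ c ∈ C, ((r, c) ∈ G ↔ c ∈ D))
    (hGD : ∀ r ∈ R, r ∉ E → ∀ c ∈ D, (r, c) ∈ G)
    (hGC : ∀ r ∈ R, r ∉ E → r ∉ B → ∃ c ∈ C \ D, (r, c) ∈ G)
    (hs : ∀ Z, E ⊆ Z → Z ⊆ E ∪ B → Z.card = D.card → matchedSum (R \ Z) (C \ D) G = s) :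
    obstructedSum R C G =
      (D.card - 1).choose E.card * (B.card - 1).choose (D.card - 1 - E.card) * s := by
  obtain ⟨r₀, hr₀⟩ := hBne
  have hr₀E : r₀ ∉ E := fun h => Finset.disjoint_left.1 hEB h hr₀
  set B' := B.erase r₀ with hB'
  have hB'c : B'.card = B.card - 1 := Finset.card_erase_of_mem hr₀
  have hEB' : Disjoint E B' := hEB.mono_right (Finset.erase_subset _ _)
  have hfilC : (C.filter fun c => (r₀, c) ∈ G) = D := by
    ext c
    rw [Finset.mem_filter]
    exact ⟨fun h => (hGB r₀ hr₀ c h.1).1 h.2, fun h => ⟨hD h, (hGB r₀ hr₀ c (hD h)).2 h⟩⟩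
  rw [← Finset.insert_erase (hB hr₀), obstructedSum_insert C G (Finset.notMem_erase r₀ R), hfilC,
    missableSum_eq_sum _ G hD hDne,
    ← Finset.sum_filter_of_ne (p := fun Z : Finset α => Z.card + 1 = D.card)
      fun Z _ hZ => by
        by_contra h
        exact hZ (by rw [missableSum_eq_zero G hDne h, zero_mul])]
  set A := Finset.filter (fun Z : Finset α => Z.card + 1 = D.card)
    ((R.erase r₀).powerset.filter fun Z => (R.erase r₀ \ Z) ×ˢ D ⊆ G ∧ G ∩ Z ×ˢ (C \ D) = ∅) with hA
  have hmem : ∀ Z, Z ∈ A ↔ E ⊆ Z ∧ Z ⊆ E ∪ B' ∧ Z.card + 1 = D.card := by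
    intro Z
    simp only [hA, Finset.mem_filter, Finset.mem_powerset, inter_product_eq_empty_iff]
    constructor
    · rintro ⟨⟨h1, h2, h3⟩, h4⟩
      refine ⟨fun r hr => ?_, fun r hr => ?_, h4⟩
      · by_contra hrZ
        obtain ⟨c, hc⟩ := hDne
        exact hGE r hr c (hD hc) (h2 (Finset.mem_product.2 ⟨Finset.mem_sdiff.2
          ⟨Finset.mem_erase.2 ⟨fun h => hr₀E (h ▸ hr), hE hr⟩, hrZ⟩, hc⟩))
      · by_contra hrEB
        have hrR := Finset.mem_erase.1 (h1 hr)
        simp only [hB', Finset.mem_union, Finset.mem_erase, not_or, not_and] at hrEB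
        obtain ⟨c, hc, hcG⟩ := hGC r hrR.2 hrEB.1 (hrEB.2 hrR.1)
        exact h3 r hr c hc hcG
    · rintro ⟨h1, h2, h3⟩
      refine ⟨⟨fun r hr => ?_, ?_, fun r hr c hc => ?_⟩, h3⟩
      · rcases Finset.mem_union.1 (h2 hr) with h | h
        · exact Finset.mem_erase.2 ⟨fun e => hr₀E (e ▸ h), hE h⟩
        · exact Finset.erase_subset_erase _ hB h
      · rintro ⟨r, c⟩ hrc
        simp only [Finset.mem_product, Finset.mem_sdiff, Finset.mem_erase] at hrc
        exact hGD r hrc.1.1.2 (fun h => hrc.1.2 (h1 h)) c hrc.2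
      · rw [Finset.mem_sdiff] at hc
        rcases Finset.mem_union.1 (h2 hr) with h | h
        · exact hGE r h c hc.1
        · rw [hGB r (Finset.mem_of_mem_erase h) c hc.1]
          exact hc.2
  have hterm : ∀ Z ∈ A, missableSum Z D G D * matchedSum (R.erase r₀ \ Z) (C \ D) G =
      (D.card - 1).choose E.card * s := by
    intro Z hZ
    obtain ⟨h1, h2, h3⟩ := (hmem Z).1 hZ
    have hZr₀ : r₀ ∉ Z := fun h => by
      rcases Finset.mem_union.1 (h2 h) with h | h
      · exact hr₀E h
      · exact Finset.notMem_erase _ _ h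
    have hU : missableSum Z D G D = obstructedSum (insert r₀ Z) D G := by
      rw [obstructedSum_insert D G hZr₀, Finset.filter_true_of_mem]
      exact fun c hc => (hGB r₀ hr₀ c (hD hc)).2 hc
    have hZEB : insert r₀ Z ⊆ E ∪ B := Finset.insert_subset (Finset.mem_union_right _ hr₀)
      (h2.trans (Finset.union_subset_union subset_rfl (Finset.erase_subset _ _)))
    have hcard : (insert r₀ Z).card = D.card := by rw [Finset.card_insert_of_notMem hZr₀, h3]
    have hEZ : E ⊆ insert r₀ Z := h1.trans (Finset.subset_insert _ _)
    have hR : R.erase r₀ \ Z = R \ insert r₀ Z := by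
      ext r; simp only [Finset.mem_sdiff, Finset.mem_erase, Finset.mem_insert]; tauto
    rw [hU, obstructedSum_block hDne hcard hEZ (fun r hr c hc => hGE r hr c (hD hc)), hR,
      hs _ hEZ hZEB hcard]
    intro r hr c hc
    rw [Finset.mem_sdiff] at hr
    exact hGD r (Finset.union_subset hE hB (hZEB hr.1)) hr.2 c hc
  rw [Finset.sum_congr rfl hterm, Finset.sum_const, nsmul_eq_mul]
  by_cases he : D.card - 1 < E.card
  · simp [Nat.choose_eq_zero_of_lt he]
  have hDpos := Finset.card_pos.2 hDne
  have hAcard : A.card = (B.card - 1).choose (D.card - 1 - E.card) := by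
    rw [← hB'c, ← Finset.card_powersetCard]
    refine Finset.card_nbij' (fun Z => Z \ E) (fun Y => E ∪ Y) ?_ ?_ ?_ ?_
    · intro Z hZ
      obtain ⟨h1, h2, h3⟩ := (hmem Z).1 hZ
      have := Finset.card_sdiff_add_card_eq_card h1
      exact Finset.mem_coe.2 (Finset.mem_powersetCard.2
        ⟨fun r hr => (Finset.mem_union.1 (h2 (Finset.mem_sdiff.1 hr).1)).resolve_left
          (Finset.mem_sdiff.1 hr).2, by dsimp only; omega⟩)
    · intro Y hY
      obtain ⟨h1, h2⟩ := Finset.mem_powersetCard.1 (Finset.mem_coe.1 hY)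
      refine Finset.mem_coe.2 ((hmem _).2 ⟨Finset.subset_union_left,
        Finset.union_subset_union subset_rfl h1, ?_⟩)
      rw [Finset.card_union_of_disjoint (hEB'.mono_right h1)]
      omega
    · intro Z hZ
      exact Finset.union_sdiff_of_subset ((hmem Z).1 hZ).1
    · intro Y hY
      obtain ⟨h1, h2⟩ := Finset.mem_powersetCard.1 (Finset.mem_coe.1 hY)
      exact Finset.union_sdiff_cancel_left (hEB'.mono_right h1)
  rw [hAcard]
  ring

end Staircase

lemma intChoose_natCast (a b : ℕ) : intChoose a b = a.choose b := by
  unfold intChoose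
  split_ifs with h
  · simp
  · rw [Nat.choose_eq_zero_of_lt (by omega), Nat.cast_zero]

lemma intChoose_of_lt {a b : ℤ} (h : a < b) : intChoose a b = 0 :=
  if_neg (by omega)

lemma fcoef_of_lt {k₀ k₁ d₁ d₂ : ℕ} (hk : k₀ < k₁) (hd : d₁ < d₂) (h : k₀ < d₁) :
    fcoef ((d₂ : ℤ) - k₀) ((d₁ : ℤ) - k₀) ((k₁ : ℤ) - k₀) =
      -((d₂ - d₁ - 1).choose (k₁ - d₁) * (k₁ - k₀ - 1).choose (d₁ - k₀ - 1) : ℕ) := by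
  rw [fcoef, if_neg (by omega)]
  have e1 : (k₁ : ℤ) - k₀ - 1 = (k₁ - k₀ - 1 : ℕ) := by omega
  have e2 : (d₁ : ℤ) - k₀ - 1 = (d₁ - k₀ - 1 : ℕ) := by omega
  have e3 : (d₂ : ℤ) - k₀ - (d₁ - k₀) - 1 = (d₂ - d₁ - 1 : ℕ) := by omega
  rw [e1, e2, e3, intChoose_natCast]
  rcases le_or_gt d₁ k₁ with h1 | h1
  · have e4 : (k₁ : ℤ) - k₀ - (d₁ - k₀) = (k₁ - d₁ : ℕ) := by omega
    rw [e4, intChoose_natCast, Nat.cast_mul]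
  · rw [Nat.choose_eq_zero_of_lt (by omega : k₁ - k₀ - 1 < d₁ - k₀ - 1)]
    simp

lemma card_filter_fin_Ico {n x y : ℕ} (hy : y ≤ n) :
    (Finset.univ.filter fun b : Fin n => x ≤ (b : ℕ) ∧ (b : ℕ) < y).card = y - x := by
  rw [← Nat.card_Ico, ← Finset.card_map Fin.valEmbedding]
  congr 1
  ext b
  simp only [Finset.mem_map, Finset.mem_filter, Finset.mem_univ, true_and, Fin.valEmbedding_apply,
    Finset.mem_Ico]
  exact ⟨by rintro ⟨c, hc, rfl⟩; exact hc, fun h => ⟨⟨b, by omega⟩, h, rfl⟩⟩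

lemma card_filter_fin_Ici {n x : ℕ} :
    (Finset.univ.filter fun b : Fin n => x ≤ (b : ℕ)).card = n - x := by
  rw [← card_filter_fin_Ico le_rfl]
  congr 1
  ext b
  simp

lemma dualCoeff_eq_obstructedSum (n : ℕ) (G : Finset (Fin n × Fin n)) :
    dualCoeff n G = obstructedSum Finset.univ Finset.univ G := by
  rw [obstructedSum, Finset.univ_product_univ, Finset.inter_univ]
  refine altSum_congr fun F _ => ?_
  have : hasPM n (Finset.univ \ F) ↔ AvoidingMatching Finset.univ Finset.univ F := by
    constructor
    · rintro ⟨σ, hσ⟩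
      exact ⟨rfl, σ, σ.injective.injOn, fun r _ => ⟨Finset.mem_univ _, by simpa using hσ r⟩⟩
    · rintro ⟨-, f, hf, hfF⟩
      rw [Finset.coe_univ, Set.injOn_univ] at hf
      exact ⟨Equiv.ofBijective f (Finite.injective_iff_bijective.1 hf),
        fun i => by simpa using (hfF i (Finset.mem_univ _)).2⟩
  rw [bpmStar]
  by_cases h : hasPM n (Finset.univ \ F)
  · rw [if_pos h, if_pos (this.1 h)]
  · rw [if_neg h, if_neg (mt this.2 h)]

/-- The closed form for the obstructed sum over the blocks of a sorted ordered graph after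
index `j`, together with some isolated rows. -/
lemma obstructedSum_sorted {n t : ℕ} {d k : ℕ → ℕ} {G : Finset (Fin n × Fin n)}
    (hdmono : ∀ i, 1 ≤ i → i < t → d i < d (i + 1)) (hdn : d t ≤ n)
    (hkmono : ∀ i, i < t → k i < k (i + 1)) (hkt : k t = n)
    (hG : ∀ j, 1 ≤ j → j ≤ t → ∀ a b : Fin n,
      k (j - 1) ≤ (a : ℕ) → (a : ℕ) < k j → ((a, b) ∈ G ↔ (b : ℕ) < d j))
    {j : ℕ} (hj : j < t) {δ : ℕ} (hδ : δ < d (j + 1)) (hδk : δ ≤ k j) {R : Finset (Fin n)}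
    (hR : ∀ a : Fin n, k j ≤ (a : ℕ) → a ∈ R)
    (hRG : ∀ a ∈ R, (a : ℕ) < k j → ∀ b : Fin n, δ ≤ (b : ℕ) → (a, b) ∉ G)
    (hcard : R.card = n - δ) :
    obstructedSum R (Finset.univ.filter fun b : Fin n => δ ≤ (b : ℕ)) G =
      (d (j + 1) - δ - 1).choose (k j - δ) *
        ((intChoose ((n : ℤ) - (k (t - 1) : ℤ) - 1) ((n : ℤ) - (d t : ℤ)) : ℝ) *
        ∏ i ∈ Finset.Icc (j + 1) (t - 1),
          (fcoef ((d (i + 1) : ℤ) - (k (i - 1) : ℤ))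
                 ((d i : ℤ) - (k (i - 1) : ℤ))
                 ((k i : ℤ) - (k (i - 1) : ℤ)) : ℝ)) := by
  have hdle : ∀ i i', 1 ≤ i → i ≤ i' → i' ≤ t → d i ≤ d i' := by
    intro i i' hi hii'
    induction i', hii' using Nat.le_induction with
    | base => exact fun _ => le_rfl
    | succ m hm ih => exact fun h => (ih (by omega)).trans (hdmono m (by omega) (by omega)).le
  have hkle : ∀ i i', i ≤ i' → i' ≤ t → k i ≤ k i' := by
    intro i i' hii'
    induction i', hii' using Nat.le_induction with
    | base => exact fun _ => le_rfl
    | succ m hm ih => exact fun h => (ih (by omega)).trans (hkmono m (by omega)).le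
  have hblock : ∀ j, j < t → ∀ a : Fin n, k j ≤ (a : ℕ) →
      ∃ i, j + 1 ≤ i ∧ i ≤ t ∧ k (i - 1) ≤ (a : ℕ) ∧ (a : ℕ) < k i := by
    intro j hj a ha
    have hex : ∃ i, (a : ℕ) < k i := ⟨t, hkt ▸ a.2⟩
    have hle : Nat.find hex ≤ t := Nat.find_min' hex (hkt ▸ a.2)
    have hji : j < Nat.find hex := by
      by_contra! h
      have := Nat.find_spec hex
      have := hkle _ _ h hj.le
      omega
    exact ⟨Nat.find hex, hji, hle, not_lt.1 (Nat.find_min hex (by omega)), Nat.find_spec hex⟩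
  induction hm : t - 1 - j using Nat.strong_induction_on generalizing j δ R with
  | _ m ih =>
  have hd1n : d (j + 1) ≤ n := (hdle (j + 1) t (by omega) hj le_rfl).trans hdn
  have hk1n : k (j + 1) ≤ n := hkt ▸ hkle (j + 1) t hj le_rfl
  have hkj := hkmono j hj
  have : Nonempty (Fin n) := ⟨⟨0, by omega⟩⟩
  set C := Finset.univ.filter fun b : Fin n => δ ≤ (b : ℕ) with hC
  set D := Finset.univ.filter fun b : Fin n => δ ≤ (b : ℕ) ∧ (b : ℕ) < d (j + 1) with hD
  set E := R.filter fun a : Fin n => (a : ℕ) < k j with hE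
  set B := Finset.univ.filter fun a : Fin n => k j ≤ (a : ℕ) ∧ (a : ℕ) < k (j + 1) with hB
  have hCD : C \ D = Finset.univ.filter fun b : Fin n => d (j + 1) ≤ (b : ℕ) := by
    ext b
    simp only [hC, hD, Finset.mem_sdiff, Finset.mem_filter, Finset.mem_univ, true_and]
    omega
  have hDcard : D.card = d (j + 1) - δ := card_filter_fin_Ico hd1n
  have hBcard : B.card = k (j + 1) - k j := card_filter_fin_Ico hk1n
  have hEcard : E.card = k j - δ := by
    have h1 : E.card + (R.filter fun a : Fin n => ¬ (a : ℕ) < k j).card = R.card :=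
      Finset.card_filter_add_card_filter_not _
    have h2 : (R.filter fun a : Fin n => ¬ (a : ℕ) < k j) =
        Finset.univ.filter fun a : Fin n => k j ≤ (a : ℕ) := by
      ext a
      simp only [Finset.mem_filter, Finset.mem_univ, true_and, not_lt]
      exact ⟨And.right, fun h => ⟨hR a h, h⟩⟩
    rw [h2, card_filter_fin_Ici, hcard] at h1
    omega
  have hnotE : ∀ a ∈ R, a ∉ E → k j ≤ (a : ℕ) := fun a ha h => by
    by_contra! h'
    exact h (Finset.mem_filter.2 ⟨ha, h'⟩)
  have hZlt : ∀ Z ⊆ E ∪ B, ∀ a ∈ Z, (a : ℕ) < k (j + 1) := by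
    intro Z hZ a ha
    have := hZ ha
    simp only [hE, hB, Finset.mem_union, Finset.mem_filter] at this
    omega
  have hZR : ∀ Z ⊆ E ∪ B, Z.card = D.card → (R \ Z).card = n - d (j + 1) := by
    intro Z hZ hZc
    have hsub : Z ⊆ R := fun a ha => by
      have := hZ ha
      simp only [hE, hB, Finset.mem_union, Finset.mem_filter] at this
      exact this.elim And.left fun h => hR a h.2.1
    have := Finset.card_sdiff_add_card_eq_card hsub
    omega
  have hrowB : ∀ a b : Fin n, k j ≤ (a : ℕ) → (a : ℕ) < k (j + 1) →
      ((a, b) ∈ G ↔ (b : ℕ) < d (j + 1)) := hG (j + 1) (by omega) hj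
  suffices h : ∃ s : ℝ, (∀ Z, E ⊆ Z → Z ⊆ E ∪ B → Z.card = D.card →
      matchedSum (R \ Z) (C \ D) G = s) ∧
      ((d (j + 1) - δ - 1).choose (k j - δ) : ℝ) *
        (k (j + 1) - k j - 1).choose (d (j + 1) - k j - 1) * s =
      (d (j + 1) - δ - 1).choose (k j - δ) *
        ((intChoose ((n : ℤ) - (k (t - 1) : ℤ) - 1) ((n : ℤ) - (d t : ℤ)) : ℝ) *
        ∏ i ∈ Finset.Icc (j + 1) (t - 1),
          (fcoef ((d (i + 1) : ℤ) - (k (i - 1) : ℤ))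
                 ((d i : ℤ) - (k (i - 1) : ℤ))
                 ((k i : ℤ) - (k (i - 1) : ℤ)) : ℝ)) by
    obtain ⟨s, hs, hval⟩ := h
    rw [← hval, obstructedSum_peel (E := E) (B := B) (D := D) (s := s), hDcard, hEcard, hBcard,
      show d (j + 1) - δ - 1 - (k j - δ) = d (j + 1) - k j - 1 by omega]
    · exact Finset.filter_subset _ _
    · exact fun a ha => hR a (Finset.mem_filter.1 ha).2.1
    · rw [Finset.disjoint_left]
      intro a ha hb
      simp only [hE, hB, Finset.mem_filter] at ha hb
      omega
    · exact Finset.card_pos.1 (by omega)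
    · exact fun b hb => Finset.mem_filter.2 ⟨Finset.mem_univ _, (Finset.mem_filter.1 hb).2.1⟩
    · exact Finset.card_pos.1 (by omega)
    · intro a ha b hb
      exact hRG a (Finset.mem_filter.1 ha).1 (Finset.mem_filter.1 ha).2 b (Finset.mem_filter.1 hb).2
    · intro a ha b hb
      rw [hrowB a b (Finset.mem_filter.1 ha).2.1 (Finset.mem_filter.1 ha).2.2]
      simp only [hC, hD, Finset.mem_filter] at hb ⊢
      tauto
    · intro a ha haE b hb
      obtain ⟨i, hi1, hi2, hi3, hi4⟩ := hblock j hj a (hnotE a ha haE)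
      rw [hG i (by omega) hi2 a b hi3 hi4]
      exact (Finset.mem_filter.1 hb).2.2.trans_le (hdle (j + 1) i (by omega) hi1 hi2)
    · intro a ha haE haB
      have hka := hnotE a ha haE
      have hka1 : k (j + 1) ≤ (a : ℕ) := by
        by_contra! h
        exact haB (by simp [hB, hka, h])
      obtain ⟨i, hi1, hi2, hi3, hi4⟩ := hblock j hj a hka
      have hij : j + 1 < i := by
        by_contra! h
        have := hkle i (j + 1) h hj
        omega
      have hdlt := hdmono (j + 1) (by omega) (by omega)
      have hdi := hdle (j + 1 + 1) i (by omega) hij hi2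
      have hdt := hdle i t (by omega) hi2 le_rfl
      refine ⟨⟨d (j + 1), by omega⟩, by simp [hCD], ?_⟩
      rw [hG i (by omega) hi2 _ _ hi3 hi4]
      exact hdlt.trans_le hdi
    · exact hs
  rcases (Nat.succ_le_of_lt hj).eq_or_lt with hjt | hjt
  · rw [Nat.succ_eq_add_one] at hjt
    refine ⟨1, fun Z hEZ hZ hZc => ?_, ?_⟩
    · have hempty : G ∩ (R \ Z) ×ˢ (C \ D) = ∅ := by
        refine inter_product_eq_empty_iff.2 fun a ha b hb => ?_
        rw [Finset.mem_sdiff] at ha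
        rw [hrowB a b (hnotE a ha.1 fun h => ha.2 (hEZ h)) (by rw [hjt, hkt]; exact a.2)]
        rw [hCD, Finset.mem_filter] at hb
        omega
      rw [matchedSum_eq, if_pos hempty, obstructedSum_of_inter_eq_empty _ hempty, sub_zero]
      rw [hZR Z hZ hZc, hCD, card_filter_fin_Ici]
    · rw [Finset.Icc_eq_empty (by omega), Finset.prod_empty, mul_one, mul_one]
      rcases le_or_gt (d (j + 1)) (k j) with h | h
      · simp [Nat.choose_eq_zero_of_lt (by omega : d (j + 1) - δ - 1 < k j - δ)]
      · subst hjt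
        rw [Nat.add_sub_cancel, hkt,
          show (n : ℤ) - k j - 1 = (n - k j - 1 : ℕ) by omega,
          show (n : ℤ) - d (j + 1) = (n - d (j + 1) : ℕ) by omega, intChoose_natCast,
          Nat.choose_symm_of_eq_add
            (by omega : n - k j - 1 = (n - d (j + 1)) + (d (j + 1) - k j - 1)), Int.cast_natCast]
  · have hd2 := hdmono (j + 1) (by omega) hjt
    have hk2 := hkmono (j + 1) hjt
    have hd2n := (hdle (j + 1 + 1) t (by omega) hjt le_rfl).trans hdn
    have hk2n : k (j + 1 + 1) ≤ n := hkt ▸ hkle (j + 1 + 1) t hjt le_rfl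
    refine ⟨-((d (j + 1 + 1) - d (j + 1) - 1).choose (k (j + 1) - d (j + 1)) *
        ((intChoose ((n : ℤ) - (k (t - 1) : ℤ) - 1) ((n : ℤ) - (d t : ℤ)) : ℝ) *
        ∏ i ∈ Finset.Icc (j + 1 + 1) (t - 1),
          (fcoef ((d (i + 1) : ℤ) - (k (i - 1) : ℤ))
                 ((d i : ℤ) - (k (i - 1) : ℤ))
                 ((k i : ℤ) - (k (i - 1) : ℤ)) : ℝ))), fun Z hEZ hZ hZc => ?_, ?_⟩
    · have hle : d (j + 1) ≤ k (j + 1) := by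
        have h1 := Finset.card_le_card hZ
        have h2 := Finset.card_union_le E B
        omega
      have hnonempty : G ∩ (R \ Z) ×ˢ (C \ D) ≠ ∅ := fun h => by
        have ha : (⟨k (j + 1), by omega⟩ : Fin n) ∈ R \ Z :=
          Finset.mem_sdiff.2 ⟨hR _ hkj.le, fun h => (hZlt Z hZ _ h).false⟩
        have hb : (⟨d (j + 1), by omega⟩ : Fin n) ∈ C \ D := by simp [hCD]
        exact inter_product_eq_empty_iff.1 h _ ha _ hb
          ((hG (j + 1 + 1) (by omega) hjt _ _ le_rfl hk2).2 hd2)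
      rw [matchedSum_eq, if_neg hnonempty, zero_sub, hCD]
      congr 1
      refine ih (t - 1 - (j + 1)) (by omega) hjt hd2 hle (R := R \ Z) (fun a ha => ?_)
        (fun a ha hak b hb => ?_) (hZR Z hZ hZc) rfl
      · exact Finset.mem_sdiff.2 ⟨hR a (hkj.le.trans ha), fun h => (hZlt Z hZ a h).not_ge ha⟩
      · rw [Finset.mem_sdiff] at ha
        rw [hrowB a b (hnotE a ha.1 fun h => ha.2 (hEZ h)) hak]
        exact hb.not_gt
    · rw [← Finset.mul_prod_Ioc_eq_prod_Icc (by omega : j + 1 ≤ t - 1),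
        show Finset.Ioc (j + 1) (t - 1) = Finset.Icc (j + 1 + 1) (t - 1) by
          ext; simp only [Finset.mem_Icc, Finset.mem_Ioc]; omega]
      rcases le_or_gt (d (j + 1)) (k j) with h | h
      · simp [Nat.choose_eq_zero_of_lt (by omega : d (j + 1) - δ - 1 < k j - δ)]
      · rw [Nat.add_sub_cancel, fcoef_of_lt hkj hd2 h]
        push_cast
        ring

/-- The dual coefficient of a sorted ordered graph with representing sequence
`(d_1,k_1),…,(d_t,k_t)` equals
`C(n−k_{t−1}−1, n−d_t) · ∏_{i=1}^{t−1} f(d_{i+1}−k_{i−1}, d_i−k_{i−1}, k_i−k_{i−1})`. -/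
theorem dual_coeff_of_sorted_ordered (n t : ℕ) (ht : 1 ≤ t) (d k : ℕ → ℕ)
    (G : Finset (Fin n × Fin n))
    (hk0 : k 0 = 0)
    (hdmono : ∀ i, 1 ≤ i → i < t → d i < d (i + 1))
    (hdn : d t ≤ n)
    (hkmono : ∀ i, i < t → k i < k (i + 1))
    (hkt : k t = n)
    (hG : ∀ j, 1 ≤ j → j ≤ t → ∀ a b : Fin n,
      k (j - 1) ≤ (a : ℕ) → (a : ℕ) < k j → ((a, b) ∈ G ↔ (b : ℕ) < d j)) :
    dualCoeff n G =
      (intChoose ((n : ℤ) - (k (t - 1) : ℤ) - 1) ((n : ℤ) - (d t : ℤ)) : ℝ) *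
        ∏ i ∈ Finset.Icc 1 (t - 1),
          (fcoef ((d (i + 1) : ℤ) - (k (i - 1) : ℤ))
                 ((d i : ℤ) - (k (i - 1) : ℤ))
                 ((k i : ℤ) - (k (i - 1) : ℤ)) : ℝ) := by
  rw [dualCoeff_eq_obstructedSum]
  have hk1 : k 0 < k 1 := hkmono 0 (by omega)
  have huniv : (Finset.univ.filter fun b : Fin n => 0 ≤ (b : ℕ)) = Finset.univ := by simp
  rcases Nat.eq_zero_or_pos (d 1) with hd1 | hd1
  · have hrow : ∀ a b : Fin n, (a : ℕ) < k 1 → (a, b) ∉ G := fun a b ha => by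
      rw [hG 1 le_rfl ht a b (by simp [hk0]) ha, hd1]
      exact Nat.not_lt_zero _
    rcases ht.eq_or_lt with rfl | ht1
    · have : Nonempty (Fin n) := ⟨⟨0, by omega⟩⟩
      rw [obstructedSum_of_inter_eq_empty rfl
        (inter_product_eq_empty_iff.2 fun a _ b _ => hrow a b (hkt ▸ a.2)),
        intChoose_of_lt (by simp [hk0, hd1])]
      simp
    · have := obstructedSum_sorted hdmono hdn hkmono hkt hG ht1 (δ := 0)
        (hd1 ▸ hdmono 1 le_rfl ht1) (Nat.zero_le _) (R := Finset.univ) (by simp)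
        (fun a _ ha b _ => hrow a b ha) (by simp)
      rw [huniv] at this
      have hd2 : d 1 < d 2 := hdmono 1 le_rfl ht1
      have hf : fcoef ((d 2 : ℤ) - k 0) ((d 1 : ℤ) - k 0) ((k 1 : ℤ) - k 0) =
          ((d 2 - 1).choose (k 1) : ℕ) := by
        rw [fcoef, if_pos (by omega), ← intChoose_natCast]
        congr 1 <;> omega
      rw [this, ← Finset.mul_prod_Ioc_eq_prod_Icc (by omega : 1 ≤ t - 1)]
      simp only [Nat.sub_self, Nat.sub_zero]
      rw [hf]
      have : Finset.Icc (1 + 1) (t - 1) = Finset.Ioc 1 (t - 1) := by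
        ext; simp only [Finset.mem_Icc, Finset.mem_Ioc]; omega
      rw [this]
      push_cast
      ring
  · have := obstructedSum_sorted hdmono hdn hkmono hkt hG ht (δ := 0) hd1 (Nat.zero_le _)
      (R := Finset.univ) (by simp) (fun a _ ha => by omega) (by simp)
    rw [huniv, hk0] at this
    simpa using this
end

section
/- Let n ∈ ℕ and let G ⊆ K_{n,n} be a graph that is not totally ordered. Then the dual coefficient of G is zero: a*_G = 0. -/
open Finset

/-- The neighbourhood `N(a)` of a left vertex `a` in the graph `G`. -/
def nbhd (n : ℕ) (G : Finset (Fin n × Fin n)) (a : Fin n) : Finset (Fin n) :=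
  Finset.univ.filter (fun b => (a, b) ∈ G)

/-- `G` is totally ordered if its left vertices can be arranged so that their
neighbourhoods form a chain. -/
def TotallyOrdered (n : ℕ) (G : Finset (Fin n × Fin n)) : Prop :=
  ∃ π : Equiv.Perm (Fin n), ∀ i j : Fin n, i ≤ j → nbhd n G (π i) ⊆ nbhd n G (π j)

section ChainCancellation

variable {L : Type*} [Lattice L] [OrderBot L]

open scoped Classical in
/-- The least element above `p` and above all elements of `C` that do not lie above `p`. -/
noncomputable def pivot (p : L) (C : Finset L) : L :=
  p ⊔ (C.filter (fun c => ¬ p ≤ c)).sup id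

open scoped Classical in
/-- Insert the pivot into `C`, or remove it if it is already there. -/
noncomputable def togglePivot (p : L) (C : Finset L) : Finset L :=
  if pivot p C ∈ C then C.erase (pivot p C) else insert (pivot p C) C

lemma le_pivot (p : L) (C : Finset L) : p ≤ pivot p C := le_sup_left

lemma pivot_comparable {p : L} {C : Finset L} (hC : IsChain (· ≤ ·) (C : Set L))
    {c : L} (hc : c ∈ C) : pivot p C ≤ c ∨ c ≤ pivot p C := by
  classical
  by_cases hpc : p ≤ c
  · refine Or.inl (sup_le hpc (Finset.sup_le fun a ha => ?_))
    rw [Finset.mem_filter] at ha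
    rcases hC.total ha.1 hc with h | h
    · exact h
    · exact absurd (hpc.trans h) ha.2
  · exact Or.inr (le_sup_of_le_right
      (Finset.le_sup (f := id) (Finset.mem_filter.mpr ⟨hc, hpc⟩)))

lemma pivot_mem {p : L} {P C : Finset L} (hp : p ∈ P) (hsup : ∀ q ∈ P, p ⊔ q ∈ P)
    (hCP : C ⊆ P) (hC : IsChain (· ≤ ·) (C : Set L)) : pivot p C ∈ P := by
  classical
  unfold pivot
  rcases (C.filter (fun c => ¬ p ≤ c)).eq_empty_or_nonempty with h | h
  · simpa [h] using hp
  · obtain ⟨m, hm⟩ := Finset.exists_maximal h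
    have hmC := (Finset.mem_filter.mp hm.prop).1
    have hle : (C.filter (fun c => ¬ p ≤ c)).sup id = m := by
      refine le_antisymm (Finset.sup_le fun a ha => ?_) (Finset.le_sup (f := id) hm.prop)
      rcases hC.total (Finset.mem_filter.mp ha).1 hmC with h' | h'
      · exact h'
      · exact hm.le_of_ge ha h'
    rw [hle]
    exact hsup m (hCP hmC)

lemma pivot_togglePivot (p : L) (C : Finset L) : pivot p (togglePivot p C) = pivot p C := by
  classical
  have hfilter : (togglePivot p C).filter (fun c => ¬ p ≤ c) = C.filter (fun c => ¬ p ≤ c) := by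
    have hp := le_pivot p C
    ext c
    unfold togglePivot
    split_ifs <;> simp only [Finset.mem_filter, Finset.mem_erase, Finset.mem_insert] <;> grind
  unfold pivot at *
  rw [hfilter]

lemma togglePivot_togglePivot (p : L) (C : Finset L) :
    togglePivot p (togglePivot p C) = C := by
  classical
  rw [togglePivot, pivot_togglePivot]
  by_cases h : pivot p C ∈ C <;> simp [togglePivot, h]

lemma neg_one_pow_card_togglePivot (p : L) (C : Finset L) :
    (-1 : ℝ) ^ (togglePivot p C).card = -(-1 : ℝ) ^ C.card := by
  classical
  by_cases h : pivot p C ∈ C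
  · rw [← Finset.card_erase_add_one h]
    simp [togglePivot, h, pow_succ]
  · simp [togglePivot, h, pow_succ]

lemma togglePivot_isChain {p : L} {C : Finset L} (hC : IsChain (· ≤ ·) (C : Set L)) :
    IsChain (· ≤ ·) (togglePivot p C : Set L) := by
  classical
  unfold togglePivot
  split_ifs
  · exact hC.mono (by simp)
  · rw [Finset.coe_insert]
    exact hC.insert fun c hc _ => pivot_comparable hC hc

lemma togglePivot_subset {p : L} {P C : Finset L} (hp : p ∈ P) (hsup : ∀ q ∈ P, p ⊔ q ∈ P)
    (hCP : C ⊆ P) (hC : IsChain (· ≤ ·) (C : Set L)) : togglePivot p C ⊆ P := by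
  classical
  unfold togglePivot
  split_ifs
  · exact (Finset.erase_subset _ _).trans hCP
  · exact Finset.insert_subset (pivot_mem hp hsup hCP hC) hCP

open scoped Classical in
/-- If `P` has an element `p` with `p ⊔ q ∈ P` for all `q ∈ P`, then the reduced Euler
characteristic of the order complex of `P` vanishes. -/
lemma sum_chains_neg_one_pow_card_eq_zero {p : L} {P : Finset L} (hp : p ∈ P)
    (hsup : ∀ q ∈ P, p ⊔ q ∈ P) :
    ∑ C ∈ P.powerset.filter (fun C : Finset L => IsChain (· ≤ ·) (C : Set L)), (-1 : ℝ) ^ C.card = 0 := by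
  refine Finset.sum_involution (fun C _ => togglePivot p C) ?_ ?_ ?_ ?_
  · intro C _
    rw [neg_one_pow_card_togglePivot, add_neg_cancel]
  · intro C _ hne heq
    have h := neg_one_pow_card_togglePivot p C
    rw [heq] at h
    exact hne (by linarith)
  · intro C hC
    simp only [Finset.mem_filter, Finset.mem_powerset] at hC ⊢
    exact ⟨togglePivot_subset hp hsup hC.1 hC.2, togglePivot_isChain hC.2⟩
  · intro C _
    exact togglePivot_togglePivot p C

end ChainCancellation

lemma sum_powerset_neg_one_pow_sdiff_eq_zero {α : Type*} [DecidableEq α] {U G : Finset α}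
    (hUG : U ≠ G) :
    ∑ F ∈ G.powerset, (-1 : ℝ) ^ (G \ F).card * (if U ⊆ F then 1 else 0) = 0 := by
  by_cases hsub : U ⊆ G
  · have hss := hsub.ssubset_of_ne hUG
    obtain ⟨e, heG, heU⟩ := Finset.exists_of_ssubset hss
    rw [← Finset.insert_erase heG, Finset.sum_powerset_insert (Finset.notMem_erase e G),
      ← Finset.sum_add_distrib]
    refine Finset.sum_eq_zero fun F hF => ?_
    have heF : e ∉ F := fun h => by simpa using Finset.mem_powerset.mp hF h
    have hU : U ⊆ insert e F ↔ U ⊆ F := by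
      rw [Finset.subset_insert_iff_of_notMem heU]
    have hcard : insert e (G.erase e) \ F = insert e (insert e (G.erase e) \ insert e F) := by
      ext x
      simp only [Finset.mem_sdiff, Finset.mem_insert, Finset.mem_erase]
      grind
    rw [hcard, Finset.card_insert_of_notMem (by simp)]
    simp only [hU, pow_succ]
    ring
  · refine Finset.sum_eq_zero fun F hF => ?_
    rw [if_neg fun h => hsub (h.trans (Finset.mem_powerset.mp hF)), mul_zero]

/-- Pairs `(S, T)` of vertex sets, ordered by inclusion of `S` and reverse inclusion of `T`. -/
abbrev VertexPair (n : ℕ) : Type := Finset (Fin n) × (Finset (Fin n))ᵒᵈ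

namespace VertexPair

variable {n : ℕ}

/-- The edges of the biclique on the vertex sets `S` and `T`. -/
def edges (q : VertexPair n) : Finset (Fin n × Fin n) := q.1 ×ˢ OrderDual.ofDual q.2

/-- The number of vertices of the biclique on `S` and `T`. -/
def size (q : VertexPair n) : ℕ := q.1.card + (OrderDual.ofDual q.2).card

lemma mem_edges {q : VertexPair n} {e : Fin n × Fin n} :
    e ∈ q.edges ↔ e.1 ∈ q.1 ∧ e.2 ∈ OrderDual.ofDual q.2 := Finset.mem_product

lemma size_sup_add_size_inf (p q : VertexPair n) :
    (p ⊔ q).size + (p ⊓ q).size = p.size + q.size := by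
  have h₁ := Finset.card_union_add_card_inter p.1 q.1
  have h₂ := Finset.card_union_add_card_inter (OrderDual.ofDual p.2) (OrderDual.ofDual q.2)
  simp only [size, Prod.fst_sup, Prod.snd_sup, Prod.fst_inf, Prod.snd_inf, _root_.ofDual_sup, _root_.ofDual_inf,
    Finset.sup_eq_union, Finset.inf_eq_inter]
  omega

lemma edges_sup_subset {p q : VertexPair n} {F : Finset (Fin n × Fin n)}
    (hp : p.edges ⊆ F) (hq : q.edges ⊆ F) : (p ⊔ q).edges ⊆ F := by
  intro e he
  simp only [mem_edges, Prod.fst_sup, Prod.snd_sup, _root_.ofDual_sup, Finset.sup_eq_union,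
    Finset.inf_eq_inter, Finset.mem_union, Finset.mem_inter] at he
  rcases he.1 with h | h
  · exact hp (mem_edges.mpr ⟨h, he.2.1⟩)
  · exact hq (mem_edges.mpr ⟨h, he.2.2⟩)

lemma edges_inf_subset {p q : VertexPair n} {F : Finset (Fin n × Fin n)}
    (hp : p.edges ⊆ F) (hq : q.edges ⊆ F) : (p ⊓ q).edges ⊆ F := by
  intro e he
  simp only [mem_edges, Prod.fst_inf, Prod.snd_inf, _root_.ofDual_inf, Finset.sup_eq_union,
    Finset.inf_eq_inter, Finset.mem_union, Finset.mem_inter] at he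
  rcases he.2 with h | h
  · exact hp (mem_edges.mpr ⟨he.1.1, h⟩)
  · exact hq (mem_edges.mpr ⟨he.1.2, h⟩)

end VertexPair

/-- The vertex pairs with more than `n` vertices: their bicliques obstruct perfect matchings
in the complement. -/
def blockers (n : ℕ) : Finset (VertexPair n) := Finset.univ.filter fun q => n < q.size

/-- The blockers whose bicliques are contained in `F`. -/
def blockersIn {n : ℕ} (F : Finset (Fin n × Fin n)) : Finset (VertexPair n) :=
  (blockers n).filter fun q => q.edges ⊆ F

lemma mem_blockersIn {n : ℕ} {F : Finset (Fin n × Fin n)} {q : VertexPair n} :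
    q ∈ blockersIn F ↔ n < q.size ∧ q.edges ⊆ F := by
  simp [blockersIn, blockers]

/-- The Frobenius–König theorem. -/
lemma hasPM_compl_iff {n : ℕ} (F : Finset (Fin n × Fin n)) :
    hasPM n (Finset.univ \ F) ↔ blockersIn F = ∅ := by
  constructor
  · rintro ⟨σ, hσ⟩
    refine Finset.eq_empty_of_forall_notMem fun q hq => ?_
    obtain ⟨hsize, hedges⟩ := mem_blockersIn.mp hq
    have hdisj : Disjoint (q.1.map σ.toEmbedding) (OrderDual.ofDual q.2) := by
      rw [Finset.disjoint_left]
      intro b hb hbT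
      obtain ⟨a, ha, rfl⟩ := Finset.mem_map.mp hb
      exact (Finset.mem_sdiff.mp (hσ a)).2 (hedges (VertexPair.mem_edges.mpr ⟨ha, hbT⟩))
    have hcard := Finset.card_le_univ (q.1.map σ.toEmbedding ∪ OrderDual.ofDual q.2)
    rw [Finset.card_union_of_disjoint hdisj, Finset.card_map, Fintype.card_fin] at hcard
    unfold VertexPair.size at hsize
    omega
  · intro hempty
    let t : Fin n → Finset (Fin n) := fun a => Finset.univ.filter fun b => (a, b) ∉ F
    have hall : ∀ S : Finset (Fin n), S.card ≤ (S.biUnion t).card := by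
      intro S
      by_contra! hlt
      let q : VertexPair n := (S, OrderDual.toDual (S.biUnion t)ᶜ)
      have hq : q ∈ blockersIn F := by
        refine mem_blockersIn.mpr ⟨?_, ?_⟩
        · have hc := Finset.card_add_card_compl (S.biUnion t)
          rw [Fintype.card_fin] at hc
          simp only [VertexPair.size, q, OrderDual.ofDual_toDual]
          omega
        · rintro ⟨a, b⟩ he
          obtain ⟨ha, hb⟩ := VertexPair.mem_edges.mp he
          by_contra hF
          exact Finset.mem_compl.mp hb (Finset.mem_biUnion.mpr ⟨a, ha, by simpa [t] using hF⟩)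
      simp [hempty] at hq
    obtain ⟨f, hinj, hf⟩ := (Finset.all_card_le_biUnion_card_iff_exists_injective t).mp hall
    refine ⟨Equiv.ofBijective f (Finite.injective_iff_bijective.mp hinj), fun i => ?_⟩
    simpa [t] using hf i

open scoped Classical in
lemma bpmStar_eq_one_sub_sum_chains {n : ℕ} (F : Finset (Fin n × Fin n)) :
    bpmStar n F = 1 - ∑ C ∈ (blockersIn F).powerset.filter
      (fun C : Finset (VertexPair n) => IsChain (· ≤ ·) (C : Set (VertexPair n))), (-1 : ℝ) ^ C.card := by
  unfold bpmStar
  rw [hasPM_compl_iff]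
  split_ifs with h
  · simp [h, Finset.filter_singleton]
  · obtain ⟨p, hp, hmax⟩ := Finset.exists_max_image (blockersIn F) VertexPair.size
      (Finset.nonempty_iff_ne_empty.mpr h)
    rw [sum_chains_neg_one_pow_card_eq_zero hp, sub_zero]
    intro q hq
    obtain ⟨hps, hpe⟩ := mem_blockersIn.mp hp
    obtain ⟨hqs, hqe⟩ := mem_blockersIn.mp hq
    refine mem_blockersIn.mpr ⟨?_, VertexPair.edges_sup_subset hpe hqe⟩
    by_contra hlt
    have hmod := VertexPair.size_sup_add_size_inf p q
    have := hmax (p ⊓ q)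
      (mem_blockersIn.mpr ⟨by omega, VertexPair.edges_inf_subset hpe hqe⟩)
    omega

lemma totallyOrdered_of_total {n : ℕ} {G : Finset (Fin n × Fin n)}
    (h : ∀ a a', nbhd n G a ⊆ nbhd n G a' ∨ nbhd n G a' ⊆ nbhd n G a) :
    TotallyOrdered n G := by
  refine ⟨Tuple.sort fun a => (nbhd n G a).card, fun i j hij => ?_⟩
  have hcard := Tuple.monotone_sort (fun a => (nbhd n G a).card) hij
  rcases h (Tuple.sort (fun a => (nbhd n G a).card) i)
    (Tuple.sort (fun a => (nbhd n G a).card) j) with h' | h'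
  · exact h'
  · exact (Finset.eq_of_subset_of_card_le h' hcard).symm.subset

lemma totallyOrdered_biUnion_edges {n : ℕ} {C : Finset (VertexPair n)}
    (hC : IsChain (· ≤ ·) (C : Set (VertexPair n))) :
    TotallyOrdered n (C.biUnion VertexPair.edges) := by
  refine totallyOrdered_of_total fun a a' => ?_
  by_contra! hnot
  obtain ⟨b, hb, hb'⟩ := Finset.not_subset.mp hnot.1
  obtain ⟨c, hc, hc'⟩ := Finset.not_subset.mp hnot.2
  simp only [nbhd, Finset.mem_filter, Finset.mem_univ, true_and, Finset.mem_biUnion,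
    VertexPair.mem_edges] at hb hb' hc hc'
  obtain ⟨p, hpC, hap, hbp⟩ := hb
  obtain ⟨q, hqC, haq, hcq⟩ := hc
  rcases hC.total hpC hqC with h | h
  · exact hc' ⟨p, hpC, hap, h.2 hcq⟩
  · exact hb' ⟨q, hqC, haq, h.2 hbp⟩

/-- If `G ⊆ K_{n,n}` is not totally ordered, then its dual coefficient vanishes. -/
theorem dual_coeff_eq_zero_of_not_totallyOrdered (n : ℕ) (G : Finset (Fin n × Fin n))
    (h : ¬ TotallyOrdered n G) : dualCoeff n G = 0 := by
  classical
  have hne : ∀ C : Finset (VertexPair n), IsChain (· ≤ ·) (C : Set (VertexPair n)) →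
      C.biUnion VertexPair.edges ≠ G := fun C hC heq => h (heq ▸ totallyOrdered_biUnion_edges hC)
  have hstar : ∀ F, bpmStar n F = (if (∅ : Finset (Fin n × Fin n)) ⊆ F then 1 else 0) -
      ∑ C ∈ (blockers n).powerset.filter
          (fun C : Finset (VertexPair n) => IsChain (· ≤ ·) (C : Set (VertexPair n))),
        (-1 : ℝ) ^ C.card * (if C.biUnion VertexPair.edges ⊆ F then 1 else 0) := by
    intro F
    rw [bpmStar_eq_one_sub_sum_chains, if_pos (Finset.empty_subset F)]
    congr 1
    simp only [mul_ite, mul_one, mul_zero]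
    rw [← Finset.sum_filter]
    refine Finset.sum_congr ?_ fun _ _ => rfl
    ext C
    simp only [blockersIn, Finset.mem_filter, Finset.mem_powerset, Finset.subset_iff,
      Finset.mem_biUnion]
    grind
  have hempty : (∅ : Finset (Fin n × Fin n)) ≠ G := by
    simpa using hne ∅ (by simp)
  simp only [dualCoeff, hstar, mul_sub, Finset.sum_sub_distrib]
  rw [sum_powerset_neg_one_pow_sdiff_eq_zero hempty, zero_sub, neg_eq_zero]
  simp only [Finset.mul_sum]
  rw [Finset.sum_comm]
  refine Finset.sum_eq_zero fun C hC => ?_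
  simp only [mul_left_comm _ ((-1 : ℝ) ^ C.card)]
  rw [← Finset.mul_sum,
    sum_powerset_neg_one_pow_sdiff_eq_zero (hne C (Finset.mem_filter.mp hC).2), mul_zero]
end

section
/- Let n ∈ ℕ and let G ⊆ K_{n,n} be a sorted ordered graph with representing sequence (d_1,k_1),…,(d_t,k_t). If there exists an index i ∈ {1,…,t−1} with d_{i+1} ≤ k_i, then a*_G = 0. -/
open Finset

/-- Containing a perfect matching is monotone in the edge set. -/
theorem hasPM_mono {n : ℕ} {E E' : Finset (Fin n × Fin n)} (h : E ⊆ E') :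
    hasPM n E → hasPM n E' := fun ⟨σ, hσ⟩ => ⟨σ, fun i => h (hσ i)⟩

/-- Hall's theorem on the complement: if the complement of `E` has no perfect matching, then `E`
contains a biclique `S × T` with `|S| + |T| > n`. -/
theorem exists_biclique_of_not_hasPM_compl {n : ℕ} {E : Finset (Fin n × Fin n)}
    (h : ¬ hasPM n (Finset.univ \ E)) :
    ∃ S T : Finset (Fin n), S ×ˢ T ⊆ E ∧ n < S.card + T.card := by
  classical
  let N : Fin n → Finset (Fin n) := fun a => Finset.univ.filter fun b => (a, b) ∉ E
  by_contra! hST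
  refine h ?_
  obtain ⟨f, hf, hfN⟩ := (Finset.all_card_le_biUnion_card_iff_exists_injective N).1 fun S => by
    have hsub : S ×ˢ (S.biUnion N)ᶜ ⊆ E := by
      rintro ⟨a, b⟩ hab
      simp only [mem_product, mem_compl, mem_biUnion, not_exists, not_and] at hab
      simpa [N] using hab.2 a hab.1
    have h1 := hST S _ hsub
    have h2 := Finset.card_add_card_compl (S.biUnion N)
    rw [Fintype.card_fin] at h2
    omega
  exact ⟨Equiv.ofBijective f (Finite.injective_iff_bijective.1 hf), fun i => by
    simpa [N] using hfN i⟩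

/-- If the complement of `E` has a perfect matching, every biclique `S × T` contained in `E`
satisfies `|S| + |T| ≤ n`. -/
theorem card_add_card_le_of_hasPM_compl {n : ℕ} {E : Finset (Fin n × Fin n)}
    (h : hasPM n (Finset.univ \ E)) {S T : Finset (Fin n)} (hST : S ×ˢ T ⊆ E) :
    S.card + T.card ≤ n := by
  obtain ⟨σ, hσ⟩ := h
  have hsub : S.map σ.toEmbedding ⊆ Tᶜ := by
    intro b hb
    obtain ⟨a, ha, rfl⟩ := Finset.mem_map.1 hb
    rw [mem_compl]
    intro hT
    exact (mem_sdiff.1 (hσ a)).2 (hST (mk_mem_product ha hT))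
  have h1 := Finset.card_le_card hsub
  have h2 := Finset.card_add_card_compl T
  rw [card_map] at h1
  rw [Fintype.card_fin] at h2
  omega

/-- An edge that lies in no biclique `S × T ⊆ G` with `|S| + |T| > n` does not influence the
dual function on the subgraphs of `G`. -/
theorem bpmStar_insert_eq {n : ℕ} {G F : Finset (Fin n × Fin n)} {e : Fin n × Fin n}
    (he : ∀ S T : Finset (Fin n), S ×ˢ T ⊆ G → e ∈ S ×ˢ T → S.card + T.card ≤ n)
    (hF : insert e F ⊆ G) : bpmStar n (insert e F) = bpmStar n F := by
  have key : hasPM n (Finset.univ \ insert e F) ↔ hasPM n (Finset.univ \ F) := by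
    refine ⟨hasPM_mono (sdiff_subset_sdiff subset_rfl (subset_insert e F)), fun h => ?_⟩
    by_contra hn
    obtain ⟨S, T, hST, hcard⟩ := exists_biclique_of_not_hasPM_compl hn
    by_cases hmem : e ∈ S ×ˢ T
    · exact absurd (he S T (hST.trans hF) hmem) (by omega)
    · have := card_add_card_le_of_hasPM_compl h ((subset_insert_iff_of_notMem hmem).1 hST)
      omega
  unfold bpmStar
  split_ifs <;> tauto

/-- The dual coefficient of `G` vanishes if some edge of `G` lies in no biclique `S × T ⊆ G` with
`|S| + |T| > n`. -/
theorem dualCoeff_eq_zero_of_mem {n : ℕ} {G : Finset (Fin n × Fin n)} {e : Fin n × Fin n}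
    (heG : e ∈ G)
    (he : ∀ S T : Finset (Fin n), S ×ˢ T ⊆ G → e ∈ S ×ˢ T → S.card + T.card ≤ n) :
    dualCoeff n G = 0 := by
  obtain ⟨H, heH, rfl⟩ : ∃ H, e ∉ H ∧ insert e H = G :=
    ⟨G.erase e, notMem_erase e G, insert_erase heG⟩
  rw [dualCoeff, sum_powerset_insert heH, ← sum_add_distrib]
  refine sum_eq_zero fun F hF => ?_
  have hFH := mem_powerset.1 hF
  have heF : e ∉ F := fun h => heH (hFH h)
  rw [bpmStar_insert_eq he (insert_subset_insert e hFH), insert_sdiff_of_notMem _ heF,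
    insert_sdiff_insert, sdiff_insert_of_notMem heH, card_insert_of_notMem (by simp [heH]), pow_succ]
  ring

/-- For a sorted ordered graph with representing sequence `(d_1,k_1),…,(d_t,k_t)`:
if `d_{i+1} ≤ k_i` for some `i ∈ {1,…,t−1}`, then `a*_G = 0`. -/
theorem dual_coeff_eq_zero_of_degenerate (n t : ℕ) (ht : 1 ≤ t) (d k : ℕ → ℕ)
    (G : Finset (Fin n × Fin n))
    (hk0 : k 0 = 0)
    (hdmono : ∀ i, 1 ≤ i → i < t → d i < d (i + 1))
    (hdn : d t ≤ n)
    (hkmono : ∀ i, i < t → k i < k (i + 1))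
    (hkt : k t = n)
    (hG : ∀ j, 1 ≤ j → j ≤ t → ∀ a b : Fin n,
      k (j - 1) ≤ (a : ℕ) → (a : ℕ) < k j → ((a, b) ∈ G ↔ (b : ℕ) < d j))
    (hdeg : ∃ i, 1 ≤ i ∧ i ≤ t - 1 ∧ d (i + 1) ≤ k i) :
    dualCoeff n G = 0 := by
  obtain ⟨i, hi1, hit, hdk⟩ := hdeg
  have hd_le : ∀ m, m ≤ i → ∀ j, 1 ≤ j → j ≤ m → d j ≤ d m := by
    intro m hm j hj hjm
    induction m, hjm using Nat.le_induction with
    | base => exact le_rfl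
    | succ m hjm ih => exact (ih (by omega)).trans (hdmono m (by omega) (by omega)).le
  have hk_le : ∀ m, i + 1 ≤ m → m ≤ t → k (i + 1) ≤ k m := by
    intro m hm hmt
    induction m, hm using Nat.le_induction with
    | base => exact le_rfl
    | succ m _ ih => exact (ih (by omega)).trans (hkmono m (by omega)).le
  have hki : k i < k (i + 1) := hkmono i (by omega)
  have hkn : k (i + 1) ≤ n := hkt ▸ hk_le t (by omega) le_rfl
  have hdi : d i < d (i + 1) := hdmono i hi1 (by omega)
  let a : Fin n := ⟨k i, by omega⟩
  let b : Fin n := ⟨d i, by omega⟩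
  have hrow : ∀ c : Fin n, (a, c) ∈ G ↔ (c : ℕ) < d (i + 1) := fun c =>
    hG (i + 1) (by omega) (by omega) a c le_rfl hki
  have hearly : ∀ s : Fin n, (s : ℕ) < k i → (s, b) ∉ G := by
    classical
    intro s hs hsG
    have hex : ∃ j, (s : ℕ) < k j := ⟨i, hs⟩
    have hj1 : 1 ≤ Nat.find hex := by
      rw [Nat.one_le_iff_ne_zero]
      intro h0
      have := Nat.find_spec hex
      rw [h0, hk0] at this
      omega
    have hji : Nat.find hex ≤ i := Nat.find_min' hex hs
    have hprev : k (Nat.find hex - 1) ≤ s :=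
      not_lt.1 (Nat.find_min hex (by omega))
    have hlt : d i < d (Nat.find hex) :=
      (hG _ hj1 (by omega) s b hprev (Nat.find_spec hex)).1 hsG
    exact absurd (hd_le i le_rfl _ hj1 hji) (by omega)
  refine dualCoeff_eq_zero_of_mem (e := (a, b)) ((hrow b).2 hdi) fun S T hST hab => ?_
  obtain ⟨haS, hbT⟩ := mem_product.1 hab
  have hS : S.card ≤ n - k i := by
    have hsub : S.map Fin.valEmbedding ⊆ Ico (k i) n := by
      intro x hx
      obtain ⟨s, hs, rfl⟩ := mem_map.1 hx
      exact mem_Ico.2 ⟨not_lt.1 fun h => hearly s h (hST (mk_mem_product hs hbT)), s.isLt⟩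
    simpa using card_le_card hsub
  have hT : T.card ≤ d (i + 1) := by
    have hsub : T.map Fin.valEmbedding ⊆ range (d (i + 1)) := by
      intro x hx
      obtain ⟨c, hc, rfl⟩ := mem_map.1 hx
      exact mem_range.2 ((hrow c).1 (hST (mk_mem_product haS hc)))
    simpa using card_le_card hsub
  omega
end
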